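/- arXiv:2409.12511 — 2 statements merged into one kernel-verified Lean document; each statement's English description precedes it below -/
import Mathlib

section
/- Let N identical balls of radius r > 0 and mass m > 0 move in a bounded open domain Ω ⊂ ℝ^d with C³ boundary, the balls moving with constant velocity between collisions, collisions between particles being elastic (conserving linear momentum and kinetic energy), and collisions between a particle and the boundary being specular reflections; assume the generic hypotheses that collisions involve only pairs of particles or one particle and the wall, that collision times form a discrete set, and that r < L(∂Ω). Denote E = (m/2) Σ_{j=1}^N |u_j(t)|² the kinetic energy (a constant of the motion) and ū = √(2E/(Nm)) the root mean square velocity. Then there exists a constant κ_d > 0, depending neither on the domain nor on the initial configuration, such that if N r K(∂Ω) < κ_d, then for every t ≥ 0, Σ_{coll.}^{(t, t+T_f)} |u_out − u_in| ≤ c_d N² ū, where the sum runs over all collisions (between particles or against the boundary) occurring in the time interval (t, t + T_f), u_out − u_in denotes the change of velocity experienced by a ball at a collision, T_f := 1/(K(∂Ω) ū), and c_d depends only on d. -/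
open MeasureTheory Metric Set Filter Topology
open scoped Pointwise ENNReal NNReal

noncomputable section

abbrev Euc (n : ℕ) := EuclideanSpace ℝ (Fin n)

/-- Integral of a real function against a signed measure. -/
def sInt {α : Type*} [MeasurableSpace α] (μ : MeasureTheory.SignedMeasure α) (f : α → ℝ) : ℝ :=
  ∫ x, f x ∂μ.toJordanDecomposition.posPart - ∫ x, f x ∂μ.toJordanDecomposition.negPart

/-- A signed measure is concentrated on the set `S`. -/
def SuppOn {α : Type*} [MeasurableSpace α] (μ : MeasureTheory.SignedMeasure α) (S : Set α) : Prop :=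
  ∀ t : Set α, MeasurableSet t → t ∩ S = ∅ → μ t = 0

/-- Total variation mass of a finite family of signed measures, seen as a vector measure,
via duality against continuous fields of pointwise Euclidean norm at most one. -/
def vmass {α : Type*} [MeasurableSpace α] [TopologicalSpace α] {ι : Type*} [Fintype ι]
    (g : ι → MeasureTheory.SignedMeasure α) : ℝ :=
  sSup { r | ∃ Y : ι → α → ℝ, (∀ i, Continuous (Y i)) ∧ (∀ x, ∑ i, (Y i x) ^ 2 ≤ 1) ∧
      r = ∑ i, sInt (g i) (Y i) }

/-- `j`-th partial derivative. -/
def pd {n : ℕ} (j : Fin n) (ψ : Euc n → ℝ) (x : Euc n) : ℝ :=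
  fderiv ℝ ψ x (EuclideanSpace.single j 1)

/-- Smooth test function compactly supported in `U`. -/
def IsTestFun {n : ℕ} (U : Set (Euc n)) (ψ : Euc n → ℝ) : Prop :=
  ContDiff ℝ (⊤ : ℕ∞) ψ ∧ HasCompactSupport ψ ∧ tsupport ψ ⊆ U

/-- A `C¹` function with compact support (representing an element of `C¹(Ū)`). -/
def IsC1 {n : ℕ} (Y : Euc n → ℝ) : Prop := ContDiff ℝ 1 Y ∧ HasCompactSupport Y

/-- A symmetric Div-BV tensor on `U`: the entries and the row-wise distributional
divergence are finite (signed) Radon measures carried by `U`. -/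
structure DivBV (n : ℕ) (U : Set (Euc n)) where
  A : Fin n → Fin n → MeasureTheory.SignedMeasure (Euc n)
  divA : Fin n → MeasureTheory.SignedMeasure (Euc n)
  symm : ∀ i j, A i j = A j i
  suppA : ∀ i j, SuppOn (A i j) U
  suppDiv : ∀ i, SuppOn (divA i) U
  weak : ∀ i, ∀ ψ : Euc n → ℝ, IsTestFun U ψ →
    ∑ j, sInt (A i j) (pd j ψ) = - sInt (divA i) ψ

/-- Positive semi-definiteness of a matrix of measures. -/
def DivBV.PSD {n : ℕ} {U : Set (Euc n)} (T : DivBV n U) : Prop :=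
  ∀ ξ : Fin n → ℝ, ∀ s : Set (Euc n), MeasurableSet s →
    0 ≤ ∑ i, ∑ j, ξ i * ξ j * (T.A i j) s

/-- Density (Radon–Nikodym derivative w.r.t. Lebesgue) of a signed measure. -/
def sdens {n : ℕ} (μ : MeasureTheory.SignedMeasure (Euc n)) (x : Euc n) : ℝ :=
  (μ.toJordanDecomposition.posPart.rnDeriv volume x).toReal -
  (μ.toJordanDecomposition.negPart.rnDeriv volume x).toReal

/-- Pointwise determinant of the absolutely continuous part of a Div-BV tensor. -/
def DivBV.detDens {n : ℕ} {U : Set (Euc n)} (T : DivBV n U) (x : Euc n) : ℝ :=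
  Matrix.det (Matrix.of fun i j => sdens (T.A i j) x)

/-- Total mass `‖A‖_{M(U)}` of the tensor. -/
def DivBV.massA {n : ℕ} {U : Set (Euc n)} (T : DivBV n U) : ℝ :=
  vmass (fun p : Fin n × Fin n => T.A p.1 p.2)

/-- Total mass `‖Div A‖_{M(U)}` of the divergence. -/
def DivBV.massDiv {n : ℕ} {U : Set (Euc n)} (T : DivBV n U) : ℝ :=
  vmass T.divA

/-- The pairing `⟨A, ∇Y⟩_U + ⟨Div A, Y⟩_U` defining the normal trace `γ_ν A`. -/
def DivBV.tracePair {n : ℕ} {U : Set (Euc n)} (T : DivBV n U) (Y : Fin n → Euc n → ℝ) : ℝ :=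
  (∑ i, ∑ j, sInt (T.A i j) (pd j (Y i))) + ∑ i, sInt (T.divA i) (Y i)

/-- The normal trace `γ_ν A` is represented by the vector-valued measure `g` on `∂U`. -/
def DivBV.TraceMeas {n : ℕ} {U : Set (Euc n)} (T : DivBV n U)
    (g : Fin n → MeasureTheory.SignedMeasure (Euc n)) : Prop :=
  (∀ i, SuppOn (g i) (frontier U)) ∧
  ∀ Y : Fin n → Euc n → ℝ, (∀ i, IsC1 (Y i)) →
    T.tracePair Y = ∑ i, sInt (g i) (Y i)

/-- The tangential part `γ_ν^τ A` of the normal trace is represented by the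
vector-valued measure `g` on `∂U` (with outer unit normal field `ν`): `g` is carried by `∂U`,
is tangential, and represents the trace pairing against all `C¹` fields tangential along `∂U`. -/
def DivBV.TangTraceMeas {n : ℕ} {U : Set (Euc n)} (T : DivBV n U) (ν : Euc n → Euc n)
    (g : Fin n → MeasureTheory.SignedMeasure (Euc n)) : Prop :=
  (∀ i, SuppOn (g i) (frontier U)) ∧
  (∀ φ : Euc n → ℝ, Continuous φ → ∑ i, sInt (g i) (fun x => φ x * ν x i) = 0) ∧
  ∀ Y : Fin n → Euc n → ℝ, (∀ i, IsC1 (Y i)) →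
    (∀ x ∈ frontier U, ∑ i, Y i x * ν x i = 0) →
    T.tracePair Y = ∑ i, sInt (g i) (Y i)

/-- A domain whose boundary is a `C^k` hypersurface, presented by a defining function. -/
structure CkDomain (n k : ℕ) (U : Set (Euc n)) where
  f : Euc n → ℝ
  O : Set (Euc n)
  opO : IsOpen O
  front : frontier U ⊆ O
  smooth : ContDiffOn ℝ k f O
  grad_ne : ∀ x ∈ frontier U, gradient f x ≠ 0
  neg : ∀ x ∈ O ∩ U, f x < 0
  pos : ∀ x ∈ O \ closure U, 0 < f x
  zero : ∀ x ∈ frontier U, f x = 0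

/-- The outer unit normal field (normalized gradient of the defining function). -/
def CkDomain.nu {n k : ℕ} {U : Set (Euc n)} (B : CkDomain n k U) (x : Euc n) : Euc n :=
  ‖gradient B.f x‖⁻¹ • gradient B.f x

/-- `L(Σ)`: the largest `L` such that every point at distance `< L` of `Σ` has a unique
nearest point on `Σ`. -/
def uniqRadius {n : ℕ} (S : Set (Euc n)) : ℝ :=
  sSup { L : ℝ | 0 ≤ L ∧ ∀ x : Euc n, infDist x S < L →
    ∃! a, a ∈ S ∧ dist x a = infDist x S }

open Classical in
/-- Nearest-point projection on `S` (junk value if no nearest point exists). -/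
def nearestPt {n : ℕ} (S : Set (Euc n)) (x : Euc n) : Euc n :=
  if h : ∃ a, a ∈ S ∧ dist x a = infDist x S then h.choose else x

/-- The geometric extension `ν ∘ π_Σ` of the unit normal to a tubular neighbourhood. -/
def CkDomain.nuGeo {n k : ℕ} {U : Set (Euc n)} (B : CkDomain n k U) (x : Euc n) : Euc n :=
  B.nu (nearestPt (frontier U) x)

/-- `K(Σ) = max (1/L(Σ), L(Σ) ‖D²ν‖_∞)`. -/
def CkDomain.Kconst {n k : ℕ} {U : Set (Euc n)} (B : CkDomain n k U) : ℝ :=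
  max (uniqRadius (frontier U))⁻¹
    (uniqRadius (frontier U) *
      sSup ((fun a => ‖fderiv ℝ (fderiv ℝ B.nuGeo) a‖) '' frontier U))

/-- The reflection `σ(x) = 2π_Σ(x) − x` across `Σ`. -/
def reflAcross {n : ℕ} (S : Set (Euc n)) (x : Euc n) : Euc n :=
  (2 : ℝ) • nearestPt S x - x


/-- Hard sphere dynamics of `N` identical balls of radius `r` and mass `m` in a domain `Ω`
with outer unit normal field `ν`: free flight between collisions, elastic binary collisions
(conservation of linear momentum and kinetic energy, exchange of momentum along the line of
centers), specular reflection at the boundary; collision times form a discrete (locally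
finite) set. `u j t` is the post-collisional (right) velocity and `uIn j t` the
pre-collisional (left limit) velocity of ball `j` at time `t`. -/
structure HardSpheres (d N : ℕ) (Ω : Set (Euc d)) (ν : Euc d → Euc d) (r m : ℝ) where
  y : Fin N → ℝ → Euc d
  u : Fin N → ℝ → Euc d
  uIn : Fin N → ℝ → Euc d
  coll : Set ℝ
  contY : ∀ j, Continuous (y j)
  discrete : ∀ t : ℝ, ∃ δ > (0:ℝ), coll ∩ Set.Ioo (t - δ) (t + δ) ⊆ {t}
  finColl : ∀ a b : ℝ, (coll ∩ Set.Ioo a b).Finite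
  inside : ∀ j t, Metric.closedBall (y j t) r ⊆ closure Ω
  separated : ∀ i j, i ≠ j → ∀ t, 2 * r ≤ dist (y i t) (y j t)
  free : ∀ t ∉ coll, ∀ j, HasDerivAt (y j) (u j t) t
  flat : ∀ j, ∀ s t : ℝ, s ≤ t → coll ∩ Set.Ioc s t = ∅ → u j t = u j s
  leftLim : ∀ j t, Filter.Tendsto (u j) (nhdsWithin t (Set.Iio t)) (nhds (uIn j t))
  noJump : ∀ t ∉ coll, ∀ j, u j t = uIn j t
  collLaw : ∀ t ∈ coll,
    -- elastic collision of a pair of balls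
    (∃ i j, i ≠ j ∧ dist (y i t) (y j t) = 2 * r ∧
      m • u i t + m • u j t = m • uIn i t + m • uIn j t ∧
      ‖u i t‖ ^ 2 + ‖u j t‖ ^ 2 = ‖uIn i t‖ ^ 2 + ‖uIn j t‖ ^ 2 ∧
      (∃ lam : ℝ, u i t - uIn i t = lam • (y i t - y j t)) ∧
      ∀ k, k ≠ i → k ≠ j → u k t = uIn k t) ∨
    -- specular reflection of one ball at the wall
    (∃ j, ∃ q ∈ frontier Ω, dist (y j t) q = r ∧
      u j t = uIn j t - (2 * ∑ i, uIn j t i * ν q i) • ν q ∧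
      ∀ k, k ≠ j → u k t = uIn k t)

/-! ### Geometry of the domain -/

theorem exists_ascent_direction {d : ℕ} {S : Set (Euc d)} (hS : IsCompact S) {z a : Euc d}
    (ha : a ∈ S) (haz : dist z a = infDist z S)
    (huniq : ∀ b ∈ S, dist z b = infDist z S → b = a) (hz : 0 < infDist z S)
    {θ : ℝ} (hθ : θ < 1) :
    ∃ e : Euc d, ‖e‖ = 1 ∧ ∃ η > 0, ∀ h, 0 < h → h ≤ η →
      infDist z S + θ * h ≤ infDist (z + h • e) S := by
  have hza : 0 < ‖z - a‖ := by rw [← dist_eq_norm, haz]; exact hz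
  set e : Euc d := ‖z - a‖⁻¹ • (z - a) with he
  have hen : ‖e‖ = 1 := by
    rw [he, norm_smul, norm_inv, norm_norm, inv_mul_cancel₀ hza.ne']
  have hea : inner ℝ e (z - a) = ‖z - a‖ := by
    rw [he, real_inner_smul_left, real_inner_self_eq_norm_sq]; field_simp
  set S' : Set (Euc d) := S ∩ {b | inner ℝ e (z - b) ≤ θ * ‖z - b‖} with hS'
  have hS'c : IsCompact S' :=
    hS.inter_right (isClosed_le (by fun_prop) (by fun_prop))
  obtain ⟨η, hη, hfar⟩ : ∃ η > 0, ∀ b ∈ S', infDist z S + η ≤ dist z b := by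
    rcases S'.eq_empty_or_nonempty with h0 | hne
    · exact ⟨1, one_pos, by simp [h0]⟩
    · obtain ⟨b, hb, hbmin⟩ := hS'c.exists_isMinOn hne
        (f := fun b => dist z b) (by fun_prop)
      refine ⟨dist z b - infDist z S, ?_, fun c hc => ?_⟩
      · have h1 : infDist z S ≤ dist z b := infDist_le_dist_of_mem hb.1
        have h2 : dist z b ≠ infDist z S := by
          intro h
          have := huniq b hb.1 h
          subst this
          have h3 := hb.2
          simp only [mem_ofPred_eq, hea] at h3
          nlinarith
        exact sub_pos.2 (lt_of_le_of_ne h1 h2.symm)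
      · have : dist z b ≤ dist z c := hbmin hc
        linarith
  refine ⟨e, hen, η / 2, by positivity, fun h h0 hh => ?_⟩
  refine (le_infDist ⟨a, ha⟩).2 fun b hb => ?_
  by_cases hbS : b ∈ S'
  · have h1 := hfar b hbS
    have h2 : dist z b ≤ dist z (z + h • e) + dist (z + h • e) b := dist_triangle _ _ _
    have h3 : dist z (z + h • e) = h := by
      rw [dist_self_add_right, norm_smul, hen, Real.norm_of_nonneg h0.le, mul_one]
    nlinarith
  · have h1 : θ * ‖z - b‖ < inner ℝ e (z - b) := by
      by_contra h
      exact hbS ⟨hb, not_lt.1 h⟩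
    have hzb : infDist z S ≤ ‖z - b‖ := by
      rw [← dist_eq_norm]; exact infDist_le_dist_of_mem hb
    have h2 : inner ℝ (z + h • e - b) (z - b) ≤ ‖z + h • e - b‖ * ‖z - b‖ :=
      real_inner_le_norm _ _
    have h3 : inner ℝ (z + h • e - b) (z - b) = ‖z - b‖ ^ 2 + h * inner ℝ e (z - b) := by
      rw [show z + h • e - b = (z - b) + h • e by abel, inner_add_left,
        real_inner_smul_left, real_inner_self_eq_norm_sq]
    rw [dist_eq_norm]
    have h4 : 0 < ‖z - b‖ := hz.trans_le hzb
    have h5 : (‖z - b‖ + θ * h) * ‖z - b‖ ≤ ‖z + h • e - b‖ * ‖z - b‖ := by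
      nlinarith
    have := le_of_mul_le_mul_right h5 h4
    linarith

theorem infDist_frontier_pos {d : ℕ} {Ω : Set (Euc d)} (hΩ : IsOpen Ω)
    (hne : (frontier Ω).Nonempty) {x : Euc d} (hx : x ∈ Ω) : 0 < infDist x (frontier Ω) := by
  refine (isClosed_frontier.notMem_iff_infDist_pos hne).1 fun h => ?_
  rw [hΩ.frontier_eq] at h
  exact h.2 hx

/-- If points closer than `ℓ` to the boundary have a unique projection, one can move away from
the boundary, almost at unit rate, until reaching depth `ℓ`. -/
theorem exists_deep_point {d : ℕ} {Ω : Set (Euc d)} (hΩ : IsOpen Ω)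
    (hb : Bornology.IsBounded Ω) {ℓ : ℝ}
    (hu : ∀ x : Euc d, infDist x (frontier Ω) < ℓ →
      ∃! a, a ∈ frontier Ω ∧ dist x a = infDist x (frontier Ω))
    {x : Euc d} (hx : x ∈ Ω) (hxl : infDist x (frontier Ω) < ℓ) {θ : ℝ} (h0 : 0 < θ)
    (h1 : θ < 1) :
    ∃ z ∈ closure Ω, ℓ ≤ infDist z (frontier Ω) ∧
      infDist x (frontier Ω) + θ * dist z x ≤ ℓ := by
  set S := frontier Ω with hS
  have hSne : S.Nonempty := let ⟨a, ha, _⟩ := hu x hxl; ⟨a, ha.1⟩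
  have hcl : IsCompact (closure Ω) := hb.isCompact_closure
  have hSc : IsCompact S := hcl.of_isClosed_subset isClosed_frontier frontier_subset_closure
  have hxpos : 0 < infDist x S := infDist_frontier_pos hΩ hSne hx
  have hcont : Continuous fun z : Euc d => infDist z S := continuous_infDist_pt S
  set A : Set (Euc d) := closure Ω ∩
    {z | infDist x S + θ * dist z x ≤ min (infDist z S) ℓ} with hA
  have hAc : IsCompact A :=
    hcl.inter_right (isClosed_le (by fun_prop) (hcont.min continuous_const))
  have hxA : x ∈ A := ⟨subset_closure hx, by simp [hxl.le]⟩
  obtain ⟨z, hz, hmax⟩ := hAc.exists_isMaxOn ⟨x, hxA⟩ hcont.continuousOn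
  have hzA := hz.2
  simp only [mem_ofPred_eq, le_min_iff] at hzA
  refine ⟨z, hz.1, ?_, hzA.2⟩
  by_contra! hlt
  have hzpos : 0 < infDist z S := by
    have := mul_nonneg h0.le (dist_nonneg (x := z) (y := x)); linarith
  have hzΩ : z ∈ Ω := by
    by_contra h
    have : z ∈ S := by rw [hS, hΩ.frontier_eq]; exact ⟨hz.1, h⟩
    rw [infDist_zero_of_mem this] at hzpos
    exact lt_irrefl _ hzpos
  obtain ⟨a, ⟨haS, had⟩, hau⟩ := hu z hlt
  obtain ⟨e, he, η, hη, hasc⟩ := exists_ascent_direction hSc haS had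
    (fun b hb hbd => hau b ⟨hb, hbd⟩) hzpos h1
  obtain ⟨ρ, hρ, hball⟩ := Metric.isOpen_iff.1 hΩ z hzΩ
  set h := min η (min (ρ / 2) (ℓ - infDist z S)) with hh
  have hhpos : 0 < h := lt_min hη (lt_min (by positivity) (by linarith))
  have hhρ : h ≤ ρ / 2 := (min_le_right _ _).trans (min_le_left _ _)
  have hhl : h ≤ ℓ - infDist z S := (min_le_right _ _).trans (min_le_right _ _)
  have hup := hasc h hhpos (min_le_left _ _)
  have hdz : dist (z + h • e) z = h := by
    rw [dist_self_add_left, norm_smul, he, Real.norm_of_nonneg hhpos.le, mul_one]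
  have hdx : dist (z + h • e) x ≤ h + dist z x := by
    have := dist_triangle (z + h • e) z x; linarith
  have hmem : z + h • e ∈ A := by
    refine ⟨subset_closure (hball ?_), ?_⟩
    · rw [mem_ball, hdz]; linarith
    · simp only [mem_ofPred_eq, le_min_iff]
      have := mul_le_mul_of_nonneg_left hdx h0.le
      constructor <;> nlinarith
  have := hmax hmem
  simp only [mem_ofPred_eq] at this
  nlinarith

/-- A bounded field pointing inwards along the wall and monotone up to `1 / ℓ`: the vector from
a point to the nearest point of depth at least `ℓ`, divided by `ℓ`. -/
theorem exists_inward_field {d : ℕ} {Ω : Set (Euc d)} (hΩ : IsOpen Ω)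
    (hb : Bornology.IsBounded Ω) (hne : Ω.Nonempty) {ℓ : ℝ} (hℓ : 0 < ℓ)
    (hu : ∀ x : Euc d, infDist x (frontier Ω) < ℓ →
      ∃! a, a ∈ frontier Ω ∧ dist x a = infDist x (frontier Ω)) :
    ∃ V : Euc d → Euc d,
      (∀ x ∈ Ω, ‖V x‖ ≤ 1) ∧
      (∀ x y, -(‖x - y‖ ^ 2 / ℓ) ≤ inner ℝ (V x - V y) (x - y)) ∧
      ∀ x ∈ Ω, ∀ q ∈ frontier Ω, dist x q = infDist x (frontier Ω) → dist x q < ℓ →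
        V x = ((1 - dist x q / ℓ) / dist x q) • (x - q) := by
  set S := frontier Ω with hS
  set D : Set (Euc d) := closure Ω ∩ {z | ℓ ≤ infDist z S} with hD
  have hDcl : IsClosed D :=
    isClosed_closure.inter (isClosed_le continuous_const (continuous_infDist_pt S))
  have hnear : ∀ x ∈ Ω, infDist x S < ℓ → ∀ θ, 0 < θ → θ < 1 →
      ∃ z ∈ D, infDist x S + θ * dist z x ≤ ℓ := fun x hx hxl θ h0 h1 => by
    obtain ⟨z, hz, hzl, hzd⟩ := exists_deep_point hΩ hb hu hx hxl h0 h1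
    exact ⟨z, ⟨hz, hzl⟩, hzd⟩
  have hDne : D.Nonempty := by
    obtain ⟨x, hx⟩ := hne
    by_cases hxl : infDist x S < ℓ
    · obtain ⟨z, hz, _⟩ := hnear x hx hxl (1 / 2) (by norm_num) (by norm_num)
      exact ⟨z, hz⟩
    · exact ⟨x, subset_closure hx, not_lt.1 hxl⟩
  have hdist : ∀ x ∈ Ω, infDist x S < ℓ → infDist x S + infDist x D ≤ ℓ := by
    intro x hx hxl
    have hlim : Tendsto (fun θ : ℝ => infDist x S + θ * infDist x D) (𝓝[<] 1)
        (𝓝 (infDist x S + 1 * infDist x D)) :=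
      ((by fun_prop : Continuous fun θ : ℝ => infDist x S + θ * infDist x D).tendsto 1).mono_left
        nhdsWithin_le_nhds
    rw [one_mul] at hlim
    refine le_of_tendsto hlim ?_
    filter_upwards [Ioo_mem_nhdsLT (zero_lt_one' ℝ)] with θ hθ
    obtain ⟨z, hz, hzd⟩ := hnear x hx hxl θ hθ.1 hθ.2
    have h1 : infDist x D ≤ dist z x := by
      rw [dist_comm]; exact infDist_le_dist_of_mem hz
    have := mul_le_mul_of_nonneg_left h1 hθ.1.le
    linarith
  choose c hcD hcd using fun x => hDcl.exists_infDist_eq_dist hDne x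
  refine ⟨fun x => ℓ⁻¹ • (c x - x), fun x hx => ?_, fun x y => ?_, fun x hx q hq hxq hql => ?_⟩
  · have h1 : infDist x D ≤ ℓ := by
      by_cases hxl : infDist x S < ℓ
      · have := hdist x hx hxl
        have := infDist_nonneg (x := x) (s := S)
        linarith
      · rw [infDist_zero_of_mem (show x ∈ D from ⟨subset_closure hx, not_lt.1 hxl⟩)]
        exact hℓ.le
    rw [norm_smul, norm_inv, Real.norm_of_nonneg hℓ.le, ← dist_eq_norm, dist_comm, ← hcd,
      inv_mul_le_iff₀ hℓ, mul_one]
    exact h1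
  · have h1 : ‖x - c x‖ ≤ ‖x - c y‖ := by
      rw [← dist_eq_norm, ← dist_eq_norm, ← hcd]; exact infDist_le_dist_of_mem (hcD y)
    have h2 : ‖y - c y‖ ≤ ‖y - c x‖ := by
      rw [← dist_eq_norm, ← dist_eq_norm, ← hcd]; exact infDist_le_dist_of_mem (hcD x)
    have h1' := pow_le_pow_left₀ (norm_nonneg _) h1 2
    have h2' := pow_le_pow_left₀ (norm_nonneg _) h2 2
    simp only [norm_sub_sq_real] at h1' h2'
    rw [← smul_sub, real_inner_smul_left, neg_le_iff_add_nonneg, inv_mul_eq_div, ← add_div]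
    refine div_nonneg ?_ hℓ.le
    rw [norm_sub_sq_real]
    simp only [inner_sub_left, inner_sub_right, real_inner_self_eq_norm_sq]
    rw [real_inner_comm x (c x), real_inner_comm y (c x), real_inner_comm x (c y),
      real_inner_comm y (c y), real_inner_comm x y]
    linarith
  · have hne : 0 < dist x q := by rw [hxq]; exact infDist_frontier_pos hΩ ⟨q, hq⟩ hx
    have h1 : infDist x D ≤ ℓ - dist x q := by
      have := hdist x hx (hxq ▸ hql); rw [hxq]; linarith
    have h2 : ℓ ≤ dist (c x) q := (hcD x).2.trans (infDist_le_dist_of_mem hq)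
    have h3 : dist (c x) q ≤ dist (c x) x + dist x q := dist_triangle _ _ _
    have h4 : dist (c x) x = ℓ - dist x q := by
      rw [hcd, dist_comm] at h1; linarith
    have h5 : ‖(c x - x) + (x - q)‖ = ‖c x - x‖ + ‖x - q‖ := by
      rw [sub_add_sub_cancel, ← dist_eq_norm, ← dist_eq_norm, ← dist_eq_norm]; linarith
    have h6 := (sameRay_iff_norm_add.2 h5).norm_smul_eq
    rw [← dist_eq_norm, ← dist_eq_norm, h4] at h6
    have h7 : c x - x = ((ℓ - dist x q) / dist x q) • (x - q) := by
      rw [div_eq_inv_mul, mul_smul, h6, smul_smul, inv_mul_cancel₀ hne.ne', one_smul]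
    simp only [h7, smul_smul]
    congr 1
    field_simp

namespace CkDomain

variable {d k : ℕ} {Ω : Set (Euc d)}

theorem hasFDerivAt (B : CkDomain d k Ω) (hk : k ≠ 0) {q : Euc d} (hq : q ∈ frontier Ω) :
    HasFDerivAt B.f (fderiv ℝ B.f q) q :=
  ((B.smooth.contDiffAt (B.opO.mem_nhds (B.front hq))).differentiableAt
    (by exact_mod_cast hk)).hasFDerivAt

theorem isLocalMaxOn (B : CkDomain d k Ω) {q : Euc d} (hq : q ∈ frontier Ω) :
    IsLocalMaxOn B.f (closure Ω) q := by
  filter_upwards [nhdsWithin_le_nhds (B.opO.mem_nhds (B.front hq)), self_mem_nhdsWithin]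
    with x hxO hx
  rw [B.zero q hq]
  by_cases hxi : x ∈ frontier Ω
  · exact (B.zero x hxi).le
  · have : x ∈ Ω := by
      by_contra h
      exact hxi ⟨hx, fun h' => h (interior_subset h')⟩
    exact (B.neg x ⟨hxO, this⟩).le

theorem inner_gradient_nonpos (B : CkDomain d k Ω) (hk : k ≠ 0) {y q : Euc d} {r : ℝ}
    (hball : closedBall y r ⊆ closure Ω) (hq : q ∈ frontier Ω) (hyq : dist y q ≤ r)
    {p : Euc d} (hp : p ∈ closedBall y r) : inner ℝ (gradient B.f q) (p - q) ≤ 0 := by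
  have hqb : q ∈ closedBall y r := by rwa [mem_closedBall']
  have h : fderiv ℝ B.f q (p - q) ≤ 0 :=
    ((B.isLocalMaxOn hq).on_subset hball).hasFDerivWithinAt_nonpos
      (B.hasFDerivAt hk hq).hasFDerivWithinAt
      (mem_posTangentConeAt_of_segment_subset ((convex_closedBall y r).segment_subset hqb
        (by rwa [add_sub_cancel])))
  have h' : inner ℝ (gradient B.f q) (p - q) = fderiv ℝ B.f q (p - q) :=
    InnerProductSpace.toDual_symm_apply
  rw [h']
  exact h

theorem dist_mul_norm_gradient_le (B : CkDomain d k Ω) (hk : k ≠ 0) {y q : Euc d} {r : ℝ}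
    (hr : 0 < r) (hball : closedBall y r ⊆ closure Ω) (hq : q ∈ frontier Ω)
    (hyq : dist y q ≤ r) : r * ‖gradient B.f q‖ ≤ inner ℝ (gradient B.f q) (q - y) := by
  set g := gradient B.f q
  have hg : 0 < ‖g‖ := norm_pos_iff.2 (B.grad_ne q hq)
  have h := B.inner_gradient_nonpos hk hball hq hyq (p := y + (r * ‖g‖⁻¹) • g) (by
    rw [mem_closedBall, dist_self_add_left, norm_smul, Real.norm_of_nonneg (by positivity),
      mul_assoc, inv_mul_cancel₀ hg.ne', mul_one])
  rw [show y + (r * ‖g‖⁻¹) • g - q = (r * ‖g‖⁻¹) • g - (q - y) by abel, inner_sub_right,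
    real_inner_smul_right, real_inner_self_eq_norm_sq] at h
  have : r * ‖g‖⁻¹ * ‖g‖ ^ 2 = r * ‖g‖ := by field_simp
  linarith

theorem le_dist_of_closedBall_subset (B : CkDomain d k Ω) (hk : k ≠ 0) {y q : Euc d} {r : ℝ}
    (hr : 0 < r) (hball : closedBall y r ⊆ closure Ω) (hq : q ∈ frontier Ω) : r ≤ dist y q := by
  by_contra! h
  have h1 := B.dist_mul_norm_gradient_le hk hr hball hq h.le
  have h2 := real_inner_le_norm (gradient B.f q) (q - y)
  have hg : 0 < ‖gradient B.f q‖ := norm_pos_iff.2 (B.grad_ne q hq)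
  rw [dist_comm, dist_eq_norm] at h
  nlinarith

theorem mem_of_closedBall_subset (B : CkDomain d k Ω) (hk : k ≠ 0) {y : Euc d} {r : ℝ}
    (hr : 0 < r) (hball : closedBall y r ⊆ closure Ω) : y ∈ Ω := by
  by_contra h
  have hy : y ∈ frontier Ω :=
    ⟨hball (mem_closedBall_self hr.le), fun h' => h (interior_subset h')⟩
  have := B.le_dist_of_closedBall_subset hk hr hball hy
  rw [dist_self] at this
  linarith

theorem smul_nu_eq (B : CkDomain d k Ω) (hk : k ≠ 0) {y q : Euc d} {r : ℝ}
    (hr : 0 < r) (hball : closedBall y r ⊆ closure Ω) (hq : q ∈ frontier Ω)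
    (hyq : dist y q = r) : B.nu q = r⁻¹ • (q - y) := by
  have hg : 0 < ‖gradient B.f q‖ := norm_pos_iff.2 (B.grad_ne q hq)
  have hn : ‖q - y‖ = r := by rw [← dist_eq_norm, dist_comm, hyq]
  have h1 := B.dist_mul_norm_gradient_le hk hr hball hq hyq.le
  have h2 : inner ℝ (gradient B.f q) (q - y) = ‖gradient B.f q‖ * ‖q - y‖ :=
    le_antisymm (real_inner_le_norm _ _) (by rw [hn]; linarith)
  have h3 := inner_eq_norm_mul_iff_real.1 h2
  rw [hn] at h3
  rw [nu, inv_smul_eq_iff₀ hg.ne', smul_comm, ← h3, smul_smul, inv_mul_cancel₀ hr.ne', one_smul]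

end CkDomain

theorem existsUnique_nearest_of_lt_uniqRadius {d : ℕ} {S : Set (Euc d)} {ℓ : ℝ} (hℓ : 0 ≤ ℓ)
    (h : ℓ < uniqRadius S) {x : Euc d} (hx : infDist x S < ℓ) :
    ∃! a, a ∈ S ∧ dist x a = infDist x S := by
  have hne : {L : ℝ | 0 ≤ L ∧ ∀ x : Euc d, infDist x S < L →
      ∃! a, a ∈ S ∧ dist x a = infDist x S}.Nonempty := by
    by_contra h0
    rw [uniqRadius, not_nonempty_iff_eq_empty.1 h0, Real.sSup_empty] at h
    linarith
  obtain ⟨L, hL, hlt⟩ := exists_lt_of_lt_csSup hne h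
  exact hL.2 x (hx.trans hlt)

/-! ### The unit direction map and the mutual repulsion field -/

/-- The unit vector in the direction of `z` (zero if `z = 0`). -/
def unitDir {d : ℕ} (z : Euc d) : Euc d := ‖z‖⁻¹ • z

theorem unitDir_neg {d : ℕ} (z : Euc d) : unitDir (-z) = -unitDir z := by
  simp [unitDir]

theorem norm_unitDir_le {d : ℕ} (z : Euc d) : ‖unitDir z‖ ≤ 1 := by
  rw [unitDir, norm_smul, norm_inv, norm_norm]
  exact inv_mul_le_one

theorem inner_self_unitDir {d : ℕ} (z : Euc d) : inner ℝ z (unitDir z) = ‖z‖ := by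
  rw [unitDir, real_inner_smul_right, real_inner_self_eq_norm_sq]
  rcases eq_or_ne ‖z‖ 0 with h | h
  · simp [h]
  · field_simp

theorem inner_unitDir_le {d : ℕ} (w z : Euc d) : inner ℝ w (unitDir z) ≤ ‖w‖ :=
  (real_inner_le_norm _ _).trans (mul_le_of_le_one_right (norm_nonneg _) (norm_unitDir_le z))

theorem inner_sub_unitDir_sub_nonneg {d : ℕ} (z w : Euc d) :
    0 ≤ inner ℝ (z - w) (unitDir z - unitDir w) := by
  simp only [inner_sub_left, inner_sub_right, inner_self_unitDir]
  have := inner_unitDir_le w z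
  have := inner_unitDir_le z w
  linarith

/-- The sum of the unit vectors pointing to ball `i` from the other balls. -/
def repulsion {d N : ℕ} (y : Fin N → Euc d) (i : Fin N) : Euc d :=
  ∑ k, unitDir (y i - y k)

theorem norm_repulsion_le {d N : ℕ} (y : Fin N → Euc d) (i : Fin N) : ‖repulsion y i‖ ≤ N := by
  refine (norm_sum_le _ _).trans ((Finset.sum_le_sum fun k _ => norm_unitDir_le _).trans ?_)
  simp

theorem sum_inner_repulsion_mono {d N : ℕ} (y v : Fin N → Euc d) {τ : ℝ} (hτ : 0 < τ) :
    ∑ i, inner ℝ (v i) (repulsion y i) ≤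
      ∑ i, inner ℝ (v i) (repulsion (fun i => y i + τ • v i) i) := by
  set p : Fin N → Euc d := fun i => y i + τ • v i with hp
  set D : Fin N → Fin N → Euc d := fun i k => unitDir (p i - p k) - unitDir (y i - y k) with hD
  have hanti : ∀ i k, D k i = -D i k := fun i k => by
    simp only [hD]
    rw [← neg_sub (p i), ← neg_sub (y i), unitDir_neg, unitDir_neg]
    abel
  have hdiff : ∑ i, inner ℝ (v i) (repulsion p i) - ∑ i, inner ℝ (v i) (repulsion y i)
      = ∑ i, ∑ k, inner ℝ (v i) (D i k) := by
    rw [← Finset.sum_sub_distrib]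
    refine Finset.sum_congr rfl fun i _ => ?_
    rw [← inner_sub_right, repulsion, repulsion, ← Finset.sum_sub_distrib, inner_sum]
  have hswap : ∑ i, ∑ k, inner ℝ (v i) (D i k) = ∑ i, ∑ k, inner ℝ (-v k) (D i k) := by
    rw [Finset.sum_comm]
    refine Finset.sum_congr rfl fun i _ => Finset.sum_congr rfl fun k _ => ?_
    rw [hanti i k, inner_neg_right, inner_neg_left]
  have hnonneg : 0 ≤ ∑ i, ∑ k, inner ℝ (v i - v k) (D i k) := by
    refine Finset.sum_nonneg fun i _ => Finset.sum_nonneg fun k _ => ?_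
    have h := inner_sub_unitDir_sub_nonneg (p i - p k) (y i - y k)
    rw [show p i - p k - (y i - y k) = τ • (v i - v k) by simp only [hp, smul_sub]; abel,
      real_inner_smul_left] at h
    exact nonneg_of_mul_nonneg_right h hτ
  have hsum : ∑ i, ∑ k, inner ℝ (v i - v k) (D i k)
      = ∑ i, ∑ k, inner ℝ (v i) (D i k) + ∑ i, ∑ k, inner ℝ (-v k) (D i k) := by
    simp only [sub_eq_add_neg, inner_add_left, Finset.sum_add_distrib]
  linarith

theorem two_mul_norm_le_inner_repulsion_sub {d N : ℕ} (y : Fin N → Euc d) {i j : Fin N}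
    (hij : i ≠ j) : 2 * ‖y i - y j‖ ≤ inner ℝ (y i - y j) (repulsion y i - repulsion y j) := by
  rw [repulsion, repulsion, ← Finset.sum_sub_distrib, inner_sum]
  have hterm : ∀ k, 0 ≤ inner ℝ (y i - y j) (unitDir (y i - y k) - unitDir (y j - y k)) :=
    fun k => by
      have := inner_sub_unitDir_sub_nonneg (y i - y k) (y j - y k)
      rwa [sub_sub_sub_cancel_right] at this
  have hle := Finset.sum_le_sum_of_subset_of_nonneg (Finset.subset_univ {i, j})
    (fun k _ _ => hterm k)
  rw [Finset.sum_pair hij] at hle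
  have hzero : unitDir (0 : Euc d) = 0 := by simp [unitDir]
  rw [sub_self, sub_self, hzero, zero_sub, sub_zero, ← unitDir_neg, neg_sub,
    inner_self_unitDir] at hle
  linarith

/-! ### Elementary facts on trajectories -/

theorem inner_nonpos_of_norm_le {d : ℕ} {z w : Euc d} {δ : ℝ} (hδ : 0 < δ)
    (h : ∀ s, 0 < s → s < δ → ‖z‖ ≤ ‖z - s • w‖) : inner ℝ z w ≤ 0 := by
  by_contra! hpos
  set s := min (δ / 2) (inner ℝ z w / (‖w‖ ^ 2 + 1)) with hs
  have hs0 : 0 < s := lt_min (by positivity) (by positivity)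
  have h1 := h s hs0 ((min_le_left _ _).trans_lt (by linarith))
  have h2 : s * (‖w‖ ^ 2 + 1) ≤ inner ℝ z w := (le_div_iff₀ (by positivity)).1 (min_le_right _ _)
  have h3 := pow_le_pow_left₀ (norm_nonneg _) h1 2
  rw [norm_sub_sq_real, real_inner_smul_right, norm_smul, Real.norm_of_nonneg hs0.le] at h3
  have h4 : s * (s * (‖w‖ ^ 2 + 1)) ≤ s * inner ℝ z w := mul_le_mul_of_nonneg_left h2 hs0.le
  nlinarith [mul_pos hs0 hs0, mul_pos hs0 hpos]

/-- If a quantity decreases at rate at most `κ` away from the discrete set `C` and jumps by at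
least `g` on `C`, then its increase over a window controls the sum of `g` over the window.
Here `F` is the right-continuous version of the quantity and `G` the left-continuous one. -/
theorem sum_jumps_le {C : Set ℝ} (hfin : ∀ a b : ℝ, (C ∩ Ioo a b).Finite) {F G g : ℝ → ℝ}
    {κ : ℝ} (hfree : ∀ s t, s < t → C ∩ Ioo s t = ∅ → F s - κ * (t - s) ≤ G t)
    (hjump : ∀ τ ∈ C, G τ + g τ ≤ F τ) {a b : ℝ} (hab : a < b) :
    F a - κ * (b - a) + ∑ τ ∈ (hfin a b).toFinset, g τ ≤ G b := by
  induction hn : (hfin a b).toFinset.card using Nat.strong_induction_on generalizing b with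
  | _ n ih =>
    rcases (hfin a b).toFinset.eq_empty_or_nonempty with h0 | hne
    · rw [h0, Finset.sum_empty, add_zero]
      exact hfree a b hab ((Set.Finite.toFinset_eq_empty).1 h0)
    · set τ := (hfin a b).toFinset.max' hne with hτ
      have hmem : τ ∈ (hfin a b).toFinset := Finset.max'_mem _ hne
      obtain ⟨hτC, haτ, hτb⟩ := (Set.Finite.mem_toFinset _).1 hmem
      have hsplit : (hfin a b).toFinset = insert τ (hfin a τ).toFinset := by
        ext x
        simp only [Set.Finite.mem_toFinset, Finset.mem_insert, mem_inter_iff, mem_Ioo]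
        constructor
        · rintro ⟨hx, hax, hxb⟩
          have : x ≤ τ := Finset.le_max' (hfin a b).toFinset x ((Set.Finite.mem_toFinset _).2 ⟨hx, hax, hxb⟩)
          rcases this.eq_or_lt with h | h
          · exact Or.inl h
          · exact Or.inr ⟨hx, hax, h⟩
        · rintro (rfl | ⟨hx, hax, hxt⟩)
          · exact ⟨hτC, haτ, hτb⟩
          · exact ⟨hx, hax, hxt.trans hτb⟩
      have hnot : τ ∉ (hfin a τ).toFinset := by simp
      have hgap : C ∩ Ioo τ b = ∅ := by
        refine eq_empty_of_forall_notMem fun x hx => ?_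
        have : x ≤ τ := Finset.le_max' (hfin a b).toFinset x
          ((Set.Finite.mem_toFinset _).2 ⟨hx.1, haτ.trans hx.2.1, hx.2.2⟩)
        exact (hx.2.1.trans_le this).false
      have hcard : (hfin a τ).toFinset.card < n := by
        rw [← hn, hsplit, Finset.card_insert_of_notMem hnot]
        exact Nat.lt_succ_self _
      have h1 := ih _ hcard haτ rfl
      have h2 := hjump τ hτC
      have h3 := hfree τ b hτb hgap
      rw [hsplit, Finset.sum_insert hnot]
      linarith

namespace HardSpheres

variable {d N : ℕ} {Ω : Set (Euc d)} {ν : Euc d → Euc d} {r m : ℝ}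

theorem u_eq (H : HardSpheres d N Ω ν r m) {s t x : ℝ} (hc : H.coll ∩ Ioo s t = ∅)
    (hx : x ∈ Ioo s t) (j : Fin N) : H.u j x = H.u j s :=
  H.flat j s x hx.1.le (subset_empty_iff.1 ((inter_subset_inter_right _
    (Ioc_subset_Ioo_right hx.2)).trans hc.subset))

theorem uIn_eq (H : HardSpheres d N Ω ν r m) {s t : ℝ} (hst : s < t)
    (hc : H.coll ∩ Ioo s t = ∅) (j : Fin N) : H.uIn j t = H.u j s := by
  refine tendsto_nhds_unique (H.leftLim j t) (tendsto_const_nhds.congr' ?_)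
  filter_upwards [Ioo_mem_nhdsLT hst] with x hx
  exact (H.u_eq hc hx j).symm

theorem y_eq (H : HardSpheres d N Ω ν r m) {s t : ℝ} (hst : s < t)
    (hc : H.coll ∩ Ioo s t = ∅) (j : Fin N) : H.y j t = H.y j s + (t - s) • H.u j s := by
  have hcont : Continuous fun x => H.y j x - (x - s) • H.u j s :=
    (H.contY j).sub (by fun_prop)
  have hconst : ∀ x ∈ Ioo s t, H.y j x - (x - s) • H.u j s = H.y j t - (t - s) • H.u j s := by
    intro x hx
    refine (constant_of_has_deriv_right_zero hcont.continuousOn (fun z hz => ?_) t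
      (right_mem_Icc.2 hx.2.le)).symm
    have hz' : z ∈ Ioo s t := ⟨hx.1.trans_le hz.1, hz.2⟩
    have h1 := H.free z (fun h => hc.subset ⟨h, hz'⟩) j
    rw [H.u_eq hc hz' j] at h1
    have h2 := h1.sub (((hasDerivAt_id z).sub_const s).smul_const (H.u j s))
    rw [one_smul, sub_self] at h2
    exact h2.hasDerivWithinAt
  have hlim : Tendsto (fun x => H.y j x - (x - s) • H.u j s) (𝓝[>] s)
      (𝓝 (H.y j s - (s - s) • H.u j s)) := (hcont.tendsto s).mono_left nhdsWithin_le_nhds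
  have hlim' : Tendsto (fun x => H.y j x - (x - s) • H.u j s) (𝓝[>] s)
      (𝓝 (H.y j t - (t - s) • H.u j s)) := by
    refine tendsto_const_nhds.congr' ?_
    filter_upwards [Ioo_mem_nhdsGT hst] with x hx
    exact (hconst x hx).symm
  have := tendsto_nhds_unique hlim hlim'
  rw [sub_self, zero_smul, sub_zero] at this
  rw [this]
  abel

theorem exists_gap (H : HardSpheres d N Ω ν r m) (t : ℝ) :
    ∃ s < t, H.coll ∩ Ioo s t = ∅ := by
  obtain ⟨δ, hδ, hsub⟩ := H.discrete t
  refine ⟨t - δ, by linarith, eq_empty_of_forall_notMem fun x hx => ?_⟩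
  have : x = t := hsub ⟨hx.1, hx.2.1, by linarith [hx.2.2]⟩
  exact hx.2.2.ne this

theorem exists_backward_flight (H : HardSpheres d N Ω ν r m) (t : ℝ) :
    ∃ δ > 0, ∀ s, 0 < s → s < δ → ∀ j, H.y j (t - s) = H.y j t - s • H.uIn j t := by
  obtain ⟨s₀, hs₀, hgap⟩ := H.exists_gap t
  refine ⟨t - s₀, by linarith, fun s h0 hs j => ?_⟩
  have hc : H.coll ∩ Ioo (t - s) t = ∅ := subset_empty_iff.1
    ((inter_subset_inter_right _ (Ioo_subset_Ioo_left (by linarith))).trans hgap.subset)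
  rw [H.uIn_eq (by linarith) hc, H.y_eq (by linarith : t - s < t) hc j, sub_sub_cancel]
  abel

/-- Effect of a collision on the linear functionals `∑ j, ⟪u j, X j⟫`, where `X` is either the
mutual repulsion or an inward field `V`; `J` is the impulse exchanged between two balls and `w`
the impulse received from the wall. -/
theorem exists_impulses {B : CkDomain d 3 Ω} (H : HardSpheres d N Ω B.nu r m) (hr : 0 < r)
    (hm : 0 < m) {ℓ : ℝ} (hrℓ : 2 * r ≤ ℓ) {V : Euc d → Euc d}
    (hVmono : ∀ x y, -(‖x - y‖ ^ 2 / ℓ) ≤ inner ℝ (V x - V y) (x - y))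
    (hVwall : ∀ x ∈ Ω, ∀ q ∈ frontier Ω, dist x q = infDist x (frontier Ω) → dist x q < ℓ →
      V x = ((1 - dist x q / ℓ) / dist x q) • (x - q)) {t : ℝ} (ht : t ∈ H.coll) :
    ∃ J w : ℝ, 0 ≤ J ∧ 0 ≤ w ∧ ∑ j, ‖H.u j t - H.uIn j t‖ = 2 * J + w ∧
      ∑ j, inner ℝ (H.uIn j t) (repulsion (fun i => H.y i t) j) + (2 * J - N * w) ≤
        ∑ j, inner ℝ (H.u j t) (repulsion (fun i => H.y i t) j) ∧
      ∑ j, inner ℝ (H.uIn j t) (V (H.y j t)) + (w / 2 - 2 * r / ℓ * J) ≤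
        ∑ j, inner ℝ (H.u j t) (V (H.y j t)) := by
  have hℓ : 0 < ℓ := by linarith
  obtain ⟨δ, hδ, hback⟩ := H.exists_backward_flight t
  have hdiff : ∀ X : Fin N → Euc d, ∑ j, inner ℝ (H.u j t) (X j)
      = ∑ j, inner ℝ (H.uIn j t) (X j) + ∑ j, inner ℝ (H.u j t - H.uIn j t) (X j) := fun X => by
    rw [← Finset.sum_add_distrib]
    simp only [← inner_add_left, add_sub_cancel]
  rw [hdiff, hdiff fun j => V (H.y j t)]
  simp only [add_le_add_iff_left]
  rcases H.collLaw t ht with ⟨i, j, hij, hd, hmom, hen, ⟨lam, hlam⟩, hrest⟩ |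
    ⟨j, q, hq, hd, hu, hrest⟩
  · have hdj : H.u j t - H.uIn j t = -(H.u i t - H.uIn i t) := by
      rw [← smul_add, ← smul_add] at hmom
      have := smul_right_injective (Euc d) hm.ne' hmom
      rw [eq_neg_iff_add_eq_zero, ← sub_eq_zero.2 this]
      abel
    set z := H.y i t - H.y j t with hz
    have hzn : ‖z‖ = 2 * r := by rw [hz, ← dist_eq_norm, hd]
    have hin : inner ℝ z (H.uIn i t - H.uIn j t) ≤ 0 := by
      refine inner_nonpos_of_norm_le hδ fun s h0 hs => ?_
      have := H.separated i j hij (t - s)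
      rw [hback s h0 hs, hback s h0 hs, dist_eq_norm] at this
      rwa [hzn, hz, smul_sub, sub_sub_sub_comm]
    have hlam0 : 0 ≤ lam := by
      by_contra! hneg
      have hi : H.u i t = H.uIn i t + lam • z := by rw [← hlam]; abel
      have hj : H.u j t = H.uIn j t - lam • z := by
        rw [← hlam, sub_eq_add_neg (H.uIn j t), ← hdj]; abel
      rw [hi, hj, norm_add_sq_real, norm_sub_sq_real, real_inner_smul_right,
        real_inner_smul_right, norm_smul, mul_pow, Real.norm_eq_abs, sq_abs] at hen
      rw [inner_sub_right, real_inner_comm, real_inner_comm _ z] at hin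
      have hz2 : 0 < ‖z‖ ^ 2 := by rw [hzn]; positivity
      nlinarith [mul_pos_of_neg_of_neg hneg hneg,
        mul_pos (mul_pos_of_neg_of_neg hneg hneg) hz2]
    have hpair : ∀ X : Fin N → Euc d, ∑ k, inner ℝ (H.u k t - H.uIn k t) (X k)
        = lam * inner ℝ z (X i - X j) := fun X => by
      rw [Fintype.sum_eq_add i j hij fun k hk => by
        rw [hrest k hk.1 hk.2, sub_self, inner_zero_left], hdj, hlam, inner_neg_left,
        real_inner_smul_left, real_inner_smul_left, inner_sub_right]
      ring
    refine ⟨lam * (2 * r), 0, by positivity, le_rfl, ?_, ?_, ?_⟩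
    · rw [Fintype.sum_eq_add i j hij fun k hk => by
        rw [hrest k hk.1 hk.2, sub_self, norm_zero], hdj, norm_neg, hlam, norm_smul, hzn,
        Real.norm_of_nonneg hlam0]
      ring
    · rw [hpair]
      have := two_mul_norm_le_inner_repulsion_sub (fun i => H.y i t) hij
      simp only [← hz, hzn] at this
      nlinarith
    · rw [hpair fun j => V (H.y j t), real_inner_comm]
      have := mul_le_mul_of_nonneg_left (hVmono (H.y i t) (H.y j t)) hlam0
      rw [← hz, hzn] at this
      refine le_trans (le_of_eq ?_) this
      ring
  · have hball := H.inside j t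
    have h3 : (3 : ℕ) ≠ 0 := by norm_num
    have hν := B.smul_nu_eq h3 hr hball hq hd
    have hνn : ‖B.nu q‖ = 1 := by
      rw [hν, norm_smul, norm_inv, Real.norm_of_nonneg hr.le, ← dist_eq_norm, dist_comm, hd,
        inv_mul_cancel₀ hr.ne']
    have hyq : H.y j t - q = -(r • B.nu q) := by
      rw [hν, smul_smul, mul_inv_cancel₀ hr.ne', one_smul, neg_sub]
    have hin : inner ℝ (H.y j t - q) (H.uIn j t) ≤ 0 := by
      refine inner_nonpos_of_norm_le hδ fun s h0 hs => ?_
      have := B.le_dist_of_closedBall_subset h3 hr (H.inside j (t - s)) hq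
      rw [hback s h0 hs, dist_eq_norm] at this
      rwa [← dist_eq_norm, hd, sub_right_comm]
    set w := 2 * ∑ i, H.uIn j t i * B.nu q i with hw
    have hw0 : 0 ≤ w := by
      have h1 : ∑ i, H.uIn j t i * B.nu q i = inner ℝ (B.nu q) (H.uIn j t) := by
        simp [PiLp.inner_apply]
      rw [hyq, inner_neg_left, real_inner_smul_left, neg_nonpos] at hin
      rw [hw, h1]
      have := nonneg_of_mul_nonneg_right hin hr
      linarith
    have hdu : H.u j t - H.uIn j t = -(w • B.nu q) := by rw [hu]; abel
    have hsingle : ∀ X : Fin N → Euc d, ∑ k, inner ℝ (H.u k t - H.uIn k t) (X k)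
        = -(w * inner ℝ (B.nu q) (X j)) := fun X => by
      rw [Fintype.sum_eq_single j fun k hk => by
        rw [hrest k hk, sub_self, inner_zero_left], hdu, inner_neg_left, real_inner_smul_left]
    refine ⟨0, w, le_rfl, hw0, ?_, ?_, ?_⟩
    · rw [Fintype.sum_eq_single j fun k hk => by
        rw [hrest k hk, sub_self, norm_zero], hdu, norm_neg, norm_smul, hνn,
        Real.norm_of_nonneg hw0]
      ring
    · rw [hsingle]
      have h1 := real_inner_le_norm (B.nu q) (repulsion (fun i => H.y i t) j)
      rw [hνn, one_mul] at h1
      have := mul_le_mul_of_nonneg_left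
        (h1.trans (norm_repulsion_le (fun i => H.y i t) j)) hw0
      linarith
    · have hyΩ := B.mem_of_closedBall_subset h3 hr hball
      have hinf : dist (H.y j t) q = infDist (H.y j t) (frontier Ω) := by
        refine le_antisymm ?_ (infDist_le_dist_of_mem hq)
        rw [hd]
        exact (le_infDist ⟨q, hq⟩).2 fun b hb => B.le_dist_of_closedBall_subset h3 hr hball hb
      rw [hsingle fun j => V (H.y j t), hVwall _ hyΩ q hq hinf (by rw [hd]; linarith), hyq, hd,
        inner_smul_right, inner_neg_right, real_inner_smul_right, real_inner_self_eq_norm_sq,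
        hνn]
      have h1 : r / ℓ ≤ 1 / 2 := by rw [div_le_iff₀ hℓ]; linarith
      have h2 : (1 - r / ℓ) / r * -(r * (1 : ℝ) ^ 2) = -(1 - r / ℓ) := by field_simp
      rw [h2]
      nlinarith

end HardSpheres

theorem abs_sum_inner_le {d N : ℕ} {v X : Fin N → Euc d} {c b : ℝ} (hc : 0 ≤ c) (hb : 0 ≤ b)
    (hv : ∑ j, ‖v j‖ ^ 2 = N * b ^ 2) (hX : ∀ j, ‖X j‖ ≤ c) :
    |∑ j, inner ℝ (v j) (X j)| ≤ c * (N * b) := by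
  have h1 : ∑ j, ‖v j‖ ≤ N * b := by
    refine abs_le_of_sq_le_sq' ?_ (mul_nonneg (Nat.cast_nonneg N) hb) |>.2
    have := sq_sum_le_card_mul_sum_sq (s := Finset.univ) (f := fun j => ‖v j‖)
    rw [hv, Finset.card_univ, Fintype.card_fin] at this
    linarith
  calc |∑ j, inner ℝ (v j) (X j)| ≤ ∑ j, |inner ℝ (v j) (X j)| := Finset.abs_sum_le_sum_abs _ _
    _ ≤ ∑ j, c * ‖v j‖ := Finset.sum_le_sum fun j _ => by
        rw [mul_comm]
        exact (abs_real_inner_le_norm _ _).trans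
          (mul_le_mul_of_nonneg_left (hX j) (norm_nonneg _))
    _ = c * ∑ j, ‖v j‖ := (Finset.mul_sum _ _ _).symm
    _ ≤ c * (N * b) := mul_le_mul_of_nonneg_left h1 hc

theorem total_impulse_le {n b x P W : ℝ} (hn : 1 ≤ n) (hb : 0 ≤ b) (hP : 0 ≤ P) (hx : 0 ≤ x)
    (hnx : n * x ≤ 1 / 8) (hW : W ≤ 8 * x * P + 8 * (n * b))
    (hPW : 2 * P - n * W ≤ 2 * (n * (n * b))) : 2 * P + W ≤ 38 * n ^ 2 * b := by
  have hnW : n * W ≤ P + 8 * (n * (n * b)) := by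
    have h1 := mul_le_mul_of_nonneg_left hW (zero_le_one.trans hn)
    have h2 := mul_le_mul_of_nonneg_right hnx hP
    linarith
  have hx' : x ≤ 1 / 8 := by nlinarith
  have h1 := mul_le_mul_of_nonneg_right hx' hP
  have h2 : n * b ≤ n * (n * b) := by nlinarith [mul_nonneg (zero_le_one.trans hn) hb]
  linarith

/-- Theorem 1.5 of the paper: under the smallness condition
`N r K(∂Ω) < κ_d`, the total exchanged momentum over any window of length
`T_f = (K(∂Ω) ū)⁻¹` is at most `c_d N² ū`. -/
theorem stmt5 (d : ℕ) (hd : 1 ≤ d) :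
    ∃ κ : ℝ, 0 < κ ∧ ∃ c : ℝ, 0 < c ∧
      ∀ (N : ℕ) (Ω : Set (Euc d)) (r m E : ℝ),
        0 < r → 0 < m → 0 < N →
        IsOpen Ω → Bornology.IsBounded Ω → Ω.Nonempty →
        ∀ B : CkDomain d 3 Ω, ∀ H : HardSpheres d N Ω B.nu r m,
          r < uniqRadius (frontier Ω) →
          (∀ t : ℝ, m / 2 * ∑ j, ‖H.u j t‖ ^ 2 = E) →
          (N : ℝ) * r * B.Kconst < κ →
          ∀ t : ℝ, 0 ≤ t →
            (∑ᶠ τ ∈ H.coll ∩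
                Set.Ioo t (t + 1 / (B.Kconst * Real.sqrt (2 * E / (N * m)))),
              ∑ j, ‖H.u j τ - H.uIn j τ‖) ≤
              c * (N : ℝ) ^ 2 * Real.sqrt (2 * E / (N * m)) := by
  refine ⟨1 / 8, by norm_num, 38, by norm_num, ?_⟩
  intro N Ω r m E hr hm hN hΩ hΩb hΩne B H hrL hE hκ t _
  set L := uniqRadius (frontier Ω) with hL
  set K := B.Kconst with hK
  set b := Real.sqrt (2 * E / (N * m)) with hb
  have hL0 : 0 < L := hr.trans hrL
  have hb0 : 0 ≤ b := Real.sqrt_nonneg _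
  have hKL : L⁻¹ ≤ K := le_max_left _ _
  have hK0 : 0 < K := (inv_pos.2 hL0).trans_le hKL
  have hN1 : (1 : ℝ) ≤ N := by exact_mod_cast hN
  have hrK : 0 < r * K := by positivity
  have hNrK : N * (r * K) ≤ 1 / 8 := by rw [← mul_assoc]; exact hκ.le
  rcases hb0.eq_or_lt with hbz | hbpos
  · rw [← hbz]
    simp
  have hsq : ∀ τ, ∑ j, ‖H.u j τ‖ ^ 2 = N * b ^ 2 := fun τ => by
    have h1 := hE τ
    have hE0 : 0 ≤ E := by
      rw [← h1]
      exact mul_nonneg (by positivity) (Finset.sum_nonneg fun _ _ => by positivity)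
    rw [hb, Real.sq_sqrt (by positivity), ← h1]
    field_simp
  have hsqIn : ∀ τ, ∑ j, ‖H.uIn j τ‖ ^ 2 = N * b ^ 2 := fun τ => by
    obtain ⟨s, hs, hgap⟩ := H.exists_gap τ
    simp only [H.uIn_eq hs hgap]
    exact hsq s
  set ℓ := L / 2 with hℓ
  have hℓ0 : 0 < ℓ := by positivity
  have hℓK : 1 / ℓ ≤ 2 * K := by
    have : 1 / ℓ = 2 * L⁻¹ := by rw [hℓ]; field_simp
    linarith
  have hrℓ : 2 * r ≤ ℓ := by
    have h1 : r * L⁻¹ ≤ r * K := mul_le_mul_of_nonneg_left hKL hr.le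
    have h2 : r * L⁻¹ ≤ 1 / 8 := by nlinarith
    rw [← div_eq_mul_inv, div_le_iff₀ hL0] at h2
    rw [hℓ]; linarith
  obtain ⟨V, hVle, hVmono, hVwall⟩ := exists_inward_field hΩ hΩb hΩne hℓ0
    fun x hx => existsUnique_nearest_of_lt_uniqRadius hℓ0.le (by rw [← hL, hℓ]; linarith) hx
  have himp := fun τ (hτ : τ ∈ H.coll) => H.exists_impulses hr hm hrℓ hVmono hVwall hτ
  choose! J w hJ0 hw0 hS hrep hwall using himp
  have hΩmem : ∀ j τ, H.y j τ ∈ Ω := fun j τ =>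
    B.mem_of_closedBall_subset (by norm_num) hr (H.inside j τ)
  set T := 1 / (K * b) with hT
  have hT0 : 0 < T := by positivity
  set I := (H.finColl t (t + T)).toFinset with hI
  have hIC : ∀ τ ∈ I, τ ∈ H.coll := fun τ hτ => ((Set.Finite.mem_toFinset _).1 hτ).1
  have hfreeRep : ∀ s τ, s < τ → H.coll ∩ Ioo s τ = ∅ →
      ∑ j, inner ℝ (H.u j s) (repulsion (fun i => H.y i s) j) - 0 * (τ - s) ≤
        ∑ j, inner ℝ (H.uIn j τ) (repulsion (fun i => H.y i τ) j) := by
    intro s τ hsτ hgap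
    simp only [H.uIn_eq hsτ hgap, H.y_eq hsτ hgap, zero_mul, sub_zero]
    exact sum_inner_repulsion_mono (fun i => H.y i s) (fun i => H.u i s) (sub_pos.2 hsτ)
  have hfreeWall : ∀ s τ, s < τ → H.coll ∩ Ioo s τ = ∅ →
      ∑ j, inner ℝ (H.u j s) (V (H.y j s)) - (N * b ^ 2 / ℓ) * (τ - s) ≤
        ∑ j, inner ℝ (H.uIn j τ) (V (H.y j τ)) := by
    intro s τ hsτ hgap
    rw [← hsq s, Finset.sum_div, Finset.sum_mul, ← Finset.sum_sub_distrib]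
    refine Finset.sum_le_sum fun j _ => ?_
    have hpos : 0 < τ - s := sub_pos.2 hsτ
    have h1 := hVmono (H.y j τ) (H.y j s)
    rw [H.uIn_eq hsτ hgap]
    have h2 : H.y j τ - H.y j s = (τ - s) • H.u j s := by rw [H.y_eq hsτ hgap]; abel
    rw [h2, norm_smul, Real.norm_of_nonneg hpos.le, real_inner_smul_right, real_inner_comm,
      inner_sub_right] at h1
    have h3 : (τ - s) * -(‖H.u j s‖ ^ 2 / ℓ * (τ - s)) ≤
        (τ - s) * (inner ℝ (H.u j s) (V (H.y j τ)) - inner ℝ (H.u j s) (V (H.y j s))) := by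
      refine le_trans (le_of_eq ?_) h1
      ring
    have := le_of_mul_le_mul_left h3 hpos
    linarith
  have htT : t < t + T := by linarith
  have hsumRep := sum_jumps_le H.finColl hfreeRep hrep htT
  have hsumWall := sum_jumps_le H.finColl hfreeWall hwall htT
  have hN0 : (0 : ℝ) ≤ N := by positivity
  have hR1 := abs_le.1 (abs_sum_inner_le hN0 hb0 (hsq t)
    (norm_repulsion_le (fun i => H.y i t)))
  have hR2 := abs_le.1 (abs_sum_inner_le hN0 hb0 (hsqIn (t + T))
    (norm_repulsion_le (fun i => H.y i (t + T))))
  have hW1 := abs_le.1 (abs_sum_inner_le zero_le_one hb0 (hsq t)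
    (fun j => hVle _ (hΩmem j t)))
  have hW2 := abs_le.1 (abs_sum_inner_le zero_le_one hb0 (hsqIn (t + T))
    (fun j => hVle _ (hΩmem j (t + T))))
  rw [← hI, Finset.sum_sub_distrib, ← Finset.mul_sum, ← Finset.mul_sum] at hsumRep
  rw [← hI, Finset.sum_sub_distrib, ← Finset.mul_sum, ← Finset.sum_div,
    add_sub_cancel_left] at hsumWall
  have hfinsum : ∑ᶠ τ ∈ H.coll ∩ Ioo t (t + T), ∑ j, ‖H.u j τ - H.uIn j τ‖
      = 2 * ∑ τ ∈ I, J τ + ∑ τ ∈ I, w τ := by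
    rw [finsum_mem_eq_finite_toFinset_sum _ (H.finColl t (t + T)), ← hI, Finset.mul_sum,
      ← Finset.sum_add_distrib]
    exact Finset.sum_congr rfl fun τ hτ => hS τ (hIC τ hτ)
  rw [hfinsum]
  have hP0 : 0 ≤ ∑ τ ∈ I, J τ := Finset.sum_nonneg fun τ hτ => hJ0 τ (hIC τ hτ)
  set P := ∑ τ ∈ I, J τ
  set W := ∑ τ ∈ I, w τ
  have hdrift : N * b ^ 2 / ℓ * T ≤ 2 * (N * b) := by
    have h1 : N * b ^ 2 / ℓ * T = N * b * (1 / ℓ) / K := by rw [hT]; field_simp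
    rw [h1, div_le_iff₀ hK0]
    nlinarith [mul_le_mul_of_nonneg_left hℓK (by positivity : 0 ≤ N * b)]
  have hexch : 2 * r / ℓ * P ≤ 4 * (r * K) * P := by
    refine mul_le_mul_of_nonneg_right ?_ hP0
    rw [show 2 * r / ℓ = 2 * r * (1 / ℓ) by ring]
    nlinarith [mul_le_mul_of_nonneg_left hℓK hr.le]
  exact total_impulse_le hN1 hb0 hP0 hrK.le hNrK
    (by linarith [hW1.1, hW2.2]) (by linarith [hR1.1, hR2.2])

end
end

section
/- Let ω, V ⊂ ℝⁿ be bounded open domains with C¹ boundaries, and φ : ω → V a C² diffeomorphism (extending to the closures) such that dφ is globally Lipschitz. Let A be a symmetric Div-BV tensor over ω. Then the normal trace of the push-forward φ_*A is given by ⟨γ_ν(φ_*A), Z⟩_{∂V} = ⟨γ_ν(A dφ), Z∘φ⟩_{∂ω} for every Z ∈ C¹(∂V; ℝⁿ), where the right-hand side equals Σ_{i=1}^n ⟨γ_ν(A ∇φ_i), Z_i ∘ φ⟩_{∂ω} and each vector field A ∇φ_i is div-BV with γ_ν(A ∇φ_i) = (γ_ν A) · ∇φ_i. -/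
open MeasureTheory Metric Set Filter Topology
open scoped Pointwise ENNReal NNReal

noncomputable section

/-- Entry `(i, α)` of the Jacobian matrix `dφ`. -/
def dcomp {n : ℕ} (φ : Euc n → Euc n) (i α : Fin n) (x : Euc n) : ℝ :=
  fderiv ℝ φ x (EuclideanSpace.single α 1) i

/-- Entry `(α, β)` of the Hessian `D²φ_i` of the `i`-th component of `φ`. -/
def d2comp {n : ℕ} (φ : Euc n → Euc n) (i α β : Fin n) (x : Euc n) : ℝ :=
  fderiv ℝ (fderiv ℝ φ) x (EuclideanSpace.single α 1) (EuclideanSpace.single β 1) i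

/-- Continuous and bounded on `U`. -/
def BddContOn {n : ℕ} (U : Set (Euc n)) (f : Euc n → ℝ) : Prop :=
  ContinuousOn f U ∧ ∃ C : ℝ, ∀ x ∈ U, |f x| ≤ C

section BddContOn

variable {n : ℕ} {U : Set (Euc n)} {f g : Euc n → ℝ}

lemma BddContOn.congr (hf : BddContOn U f) (h : EqOn g f U) : BddContOn U g := by
  obtain ⟨hc, C, hC⟩ := hf
  exact ⟨hc.congr h, C, fun x hx => by rw [h hx]; exact hC x hx⟩

lemma BddContOn.mul (hf : BddContOn U f) (hg : BddContOn U g) :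
    BddContOn U (fun x => f x * g x) := by
  obtain ⟨hf, C, hC⟩ := hf
  obtain ⟨hg, D, hD⟩ := hg
  refine ⟨hf.mul hg, C * D, fun x hx => ?_⟩
  rw [abs_mul]
  exact mul_le_mul (hC x hx) (hD x hx) (abs_nonneg _) ((abs_nonneg _).trans (hC x hx))

lemma BddContOn.neg (hf : BddContOn U f) : BddContOn U (fun x => -f x) := by
  obtain ⟨hf, C, hC⟩ := hf
  exact ⟨hf.neg, C, fun x hx => (abs_neg (f x)).trans_le (hC x hx)⟩

lemma BddContOn.posPart (hf : BddContOn U f) : BddContOn U (fun x => max (f x) 0) := by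
  obtain ⟨hf, C, hC⟩ := hf
  refine ⟨hf.sup continuousOn_const, C, fun x hx => ?_⟩
  rw [abs_of_nonneg (le_max_right _ _)]
  exact max_le ((le_abs_self _).trans (hC x hx)) ((abs_nonneg _).trans (hC x hx))

lemma BddContOn.comp {V : Set (Euc n)} {φ : Euc n → Euc n} (hf : BddContOn V f)
    (hφ : ContinuousOn φ U) (hm : MapsTo φ U V) : BddContOn U (fun x => f (φ x)) := by
  obtain ⟨hc, C, hC⟩ := hf
  exact ⟨hc.comp hφ hm, C, fun x hx => hC _ (hm hx)⟩

lemma BddContOn.of_compact {K : Set (Euc n)} (hK : IsCompact K) (hKU : K ⊆ U)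
    (hf : ContinuousOn f U) (h0 : ∀ x ∈ U \ K, f x = 0) : BddContOn U f := by
  obtain ⟨C, hC⟩ := hK.exists_bound_of_continuousOn (hf.mono hKU)
  refine ⟨hf, max C 0, fun x hx => ?_⟩
  by_cases hxK : x ∈ K
  · exact (hC x hxK).trans (le_max_left _ _)
  · simp [h0 x ⟨hx, hxK⟩]

lemma BddContOn.of_hasCompactSupport (hf : Continuous f) (hs : HasCompactSupport f) :
    BddContOn U f := by
  obtain ⟨C, hC⟩ := hs.exists_bound_of_continuous hf
  exact ⟨hf.continuousOn, C, fun x _ => hC x⟩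

end BddContOn

section SignedIntegral

variable {n : ℕ} {U : Set (Euc n)} {μ ν : SignedMeasure (Euc n)} {f g : Euc n → ℝ}

lemma SuppOn.jordan_compl_eq_zero (h : SuppOn μ U) (hU : MeasurableSet U) :
    μ.toJordanDecomposition.posPart Uᶜ = 0 ∧ μ.toJordanDecomposition.negPart Uᶜ = 0 := by
  obtain ⟨i, hi₁, hi₂, hi₃, hp, hn⟩ := μ.toJordanDecomposition_spec
  rw [hp, hn]
  rw [SignedMeasure.toMeasureOfZeroLE_apply _ _ hi₁ hU.compl,
    SignedMeasure.toMeasureOfLEZero_apply _ _ hi₁.compl hU.compl]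
  have h1 : μ (i ∩ Uᶜ) = 0 := h _ (hi₁.inter hU.compl) (by ext x; simp)
  have h2 : μ (iᶜ ∩ Uᶜ) = 0 := h _ (hi₁.compl.inter hU.compl) (by ext x; simp)
  exact ⟨ENNReal.coe_eq_zero.2 (Subtype.ext h1),
    ENNReal.coe_eq_zero.2 (Subtype.ext (neg_eq_zero.2 h2))⟩

lemma SuppOn.ae_mem (h : SuppOn μ U) (hU : MeasurableSet U) :
    (∀ᵐ x ∂μ.toJordanDecomposition.posPart, x ∈ U) ∧
      ∀ᵐ x ∂μ.toJordanDecomposition.negPart, x ∈ U :=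
  h.jordan_compl_eq_zero hU

lemma BddContOn.integrable_of_ae_mem {m : Measure (Euc n)} [IsFiniteMeasure m]
    (hf : BddContOn U f) (hU : MeasurableSet U) (h : ∀ᵐ x ∂m, x ∈ U) : Integrable f m := by
  obtain ⟨hc, C, hC⟩ := hf
  rw [← Measure.restrict_eq_self_of_ae_mem h]
  refine Integrable.of_bound (hc.aestronglyMeasurable hU) C ?_
  exact (ae_restrict_mem hU).mono fun x hx => hC x hx

lemma sInt_congr (h : SuppOn μ U) (hU : MeasurableSet U) (hfg : EqOn f g U) :
    sInt μ f = sInt μ g := by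
  obtain ⟨hp, hn⟩ := h.ae_mem hU
  unfold sInt
  rw [integral_congr_ae (hp.mono fun x hx => hfg hx),
    integral_congr_ae (hn.mono fun x hx => hfg hx)]

lemma sInt_add (h : SuppOn μ U) (hU : MeasurableSet U) (hf : BddContOn U f)
    (hg : BddContOn U g) : sInt μ (fun x => f x + g x) = sInt μ f + sInt μ g := by
  obtain ⟨hp, hn⟩ := h.ae_mem hU
  unfold sInt
  rw [integral_add (hf.integrable_of_ae_mem hU hp) (hg.integrable_of_ae_mem hU hp),
    integral_add (hf.integrable_of_ae_mem hU hn) (hg.integrable_of_ae_mem hU hn)]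
  ring

lemma sInt_sum {ι : Type*} (s : Finset ι) {F : ι → Euc n → ℝ} (h : SuppOn μ U)
    (hU : MeasurableSet U) (hF : ∀ i, BddContOn U (F i)) :
    sInt μ (fun x => ∑ i ∈ s, F i x) = ∑ i ∈ s, sInt μ (F i) := by
  obtain ⟨hp, hn⟩ := h.ae_mem hU
  unfold sInt
  rw [integral_finsetSum _ fun i _ => (hF i).integrable_of_ae_mem hU hp,
    integral_finsetSum _ fun i _ => (hF i).integrable_of_ae_mem hU hn, Finset.sum_sub_distrib]

lemma tendsto_sInt {F : ℕ → Euc n → ℝ} (h : SuppOn μ U) (hU : MeasurableSet U)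
    (hF : ∀ k, ContinuousOn (F k) U) {C : ℝ} (hC : ∀ k, ∀ x ∈ U, |F k x| ≤ C)
    (hlim : ∀ x ∈ U, Tendsto (fun k => F k x) atTop (𝓝 (f x))) :
    Tendsto (fun k => sInt μ (F k)) atTop (𝓝 (sInt μ f)) := by
  obtain ⟨hp, hn⟩ := h.ae_mem hU
  have key : ∀ (m : Measure (Euc n)) [IsFiniteMeasure m], (∀ᵐ x ∂m, x ∈ U) →
      Tendsto (fun k => ∫ x, F k x ∂m) atTop (𝓝 (∫ x, f x ∂m)) := by
    intro m _ hm
    refine tendsto_integral_of_dominated_convergence (fun _ => C) (fun k => ?_)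
      (integrable_const _) (fun k => hm.mono fun x hx => hC k x hx)
      (hm.mono fun x hx => hlim x hx)
    exact (BddContOn.integrable_of_ae_mem ⟨hF k, C, hC k⟩ hU hm).aestronglyMeasurable
  exact (key _ hp).sub (key _ hn)

/-- A signed measure presented as a difference of finite measures. -/
lemma sInt_toSignedMeasure_sub {m₁ m₂ : Measure (Euc n)} [IsFiniteMeasure m₁]
    [IsFiniteMeasure m₂] (h : SuppOn (m₁.toSignedMeasure - m₂.toSignedMeasure) U)
    (hU : MeasurableSet U) (h₁ : ∀ᵐ x ∂m₁, x ∈ U) (h₂ : ∀ᵐ x ∂m₂, x ∈ U)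
    (hf : BddContOn U f) :
    sInt (m₁.toSignedMeasure - m₂.toSignedMeasure) f = ∫ x, f x ∂m₁ - ∫ x, f x ∂m₂ := by
  obtain ⟨hp, hn⟩ := h.ae_mem hU
  set s := m₁.toSignedMeasure - m₂.toSignedMeasure with hs
  have e := s.toSignedMeasure_toJordanDecomposition
  rw [JordanDecomposition.toSignedMeasure, hs, sub_eq_sub_iff_add_eq_add, ← hs,
    ← Measure.toSignedMeasure_add, ← Measure.toSignedMeasure_add,
    Measure.toSignedMeasure_eq_toSignedMeasure_iff] at e
  have e' := congrArg (fun m => ∫ x, f x ∂m) e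
  rw [integral_add_measure (hf.integrable_of_ae_mem hU hp) (hf.integrable_of_ae_mem hU h₂),
    integral_add_measure (hf.integrable_of_ae_mem hU h₁) (hf.integrable_of_ae_mem hU hn)] at e'
  unfold sInt
  linarith

lemma suppOn_toSignedMeasure_sub {m₁ m₂ : Measure (Euc n)} [IsFiniteMeasure m₁]
    [IsFiniteMeasure m₂] (h₁ : ∀ᵐ x ∂m₁, x ∈ U) (h₂ : ∀ᵐ x ∂m₂, x ∈ U) :
    SuppOn (m₁.toSignedMeasure - m₂.toSignedMeasure) U := by
  intro t ht htU
  have hsub : t ⊆ Uᶜ := fun x hx hxU => by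
    have : x ∈ t ∩ U := ⟨hx, hxU⟩
    simp [htU] at this
  rw [Measure.toSignedMeasure_sub_apply ht, measureReal_def, measureReal_def,
    measure_mono_null hsub h₁, measure_mono_null hsub h₂]
  simp

lemma SuppOn.add (hμ : SuppOn μ U) (hν : SuppOn ν U) : SuppOn (μ + ν) U := by
  intro t ht h
  simp [hμ t ht h, hν t ht h]

lemma sInt_add_measure (hμ : SuppOn μ U) (hν : SuppOn ν U) (hU : MeasurableSet U)
    (hf : BddContOn U f) : sInt (μ + ν) f = sInt μ f + sInt ν f := by
  obtain ⟨hp, hn⟩ := hμ.ae_mem hU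
  obtain ⟨hp', hn'⟩ := hν.ae_mem hU
  have e : μ + ν = (μ.toJordanDecomposition.posPart +
        ν.toJordanDecomposition.posPart).toSignedMeasure -
      (μ.toJordanDecomposition.negPart + ν.toJordanDecomposition.negPart).toSignedMeasure := by
    conv_lhs => rw [← μ.toSignedMeasure_toJordanDecomposition,
      ← ν.toSignedMeasure_toJordanDecomposition]
    rw [Measure.toSignedMeasure_add, Measure.toSignedMeasure_add,
      JordanDecomposition.toSignedMeasure, JordanDecomposition.toSignedMeasure]
    abel
  have hs := hμ.add hν
  rw [e] at hs ⊢
  rw [sInt_toSignedMeasure_sub hs hU (ae_add_measure_iff.2 ⟨hp, hp'⟩)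
    (ae_add_measure_iff.2 ⟨hn, hn'⟩) hf,
    integral_add_measure (hf.integrable_of_ae_mem hU hp) (hf.integrable_of_ae_mem hU hp'),
    integral_add_measure (hf.integrable_of_ae_mem hU hn) (hf.integrable_of_ae_mem hU hn')]
  unfold sInt
  ring

lemma exists_sInt_eq_sum {ι : Type*} (s : Finset ι) (ms : ι → SignedMeasure (Euc n))
    (hU : MeasurableSet U) (h : ∀ i, SuppOn (ms i) U) :
    ∃ μ : SignedMeasure (Euc n), SuppOn μ U ∧
      ∀ f, BddContOn U f → sInt μ f = ∑ i ∈ s, sInt (ms i) f := by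
  classical
  induction s using Finset.induction_on with
  | empty =>
    refine ⟨0, fun t _ _ => by simp, fun f _ => ?_⟩
    simp [sInt, SignedMeasure.toJordanDecomposition_zero]
  | insert a s ha ih =>
    obtain ⟨μ, hμ, hμf⟩ := ih
    refine ⟨ms a + μ, (h a).add hμ, fun f hf => ?_⟩
    rw [sInt_add_measure (h a) hμ hU hf, hμf f hf, Finset.sum_insert ha]

/-- Multiplication of a signed measure by a bounded density. -/
lemma exists_sInt_eq_mul (h : SuppOn μ U) (hU : MeasurableSet U) {w : Euc n → ℝ}
    (hw : BddContOn U w) :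
    ∃ ν : SignedMeasure (Euc n), SuppOn ν U ∧
      ∀ f, BddContOn U f → sInt ν f = sInt μ (fun x => w x * f x) := by
  classical
  obtain ⟨hp, hn⟩ := h.ae_mem hU
  set p := μ.toJordanDecomposition.posPart
  set q := μ.toJordanDecomposition.negPart
  obtain ⟨hwc, C, hC⟩ := id hw
  set w' : Euc n → ℝ := U.indicator w with hw'
  have hm : Measurable w' := by
    rw [hw', ← piecewise_eq_indicator]
    exact hwc.measurable_piecewise continuousOn_const hU
  have hb : ∀ x, |w' x| ≤ |C| := by
    intro x
    by_cases hx : x ∈ U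
    · rw [hw', indicator_of_mem hx]
      exact (hC x hx).trans (le_abs_self _)
    · rw [hw', indicator_of_notMem hx]
      simp
  have fin : ∀ (m : Measure (Euc n)) [IsFiniteMeasure m] (v : Euc n → ℝ),
      (∀ x, |v x| ≤ |C|) → IsFiniteMeasure (m.withDensity fun x => ENNReal.ofReal (v x)) := by
    intro m _ v hv
    refine isFiniteMeasure_withDensity_ofReal ?_
    exact HasFiniteIntegral.of_bounded (C := |C|) (Eventually.of_forall hv)
  have aem : ∀ (m : Measure (Euc n)) (v : Euc n → ℝ), (∀ᵐ x ∂m, x ∈ U) →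
      ∀ᵐ x ∂(m.withDensity fun x => ENNReal.ofReal (v x)), x ∈ U :=
    fun m v hm => (withDensity_absolutelyContinuous _ _).ae_le hm
  have hb' : ∀ x, |-w' x| ≤ |C| := fun x => by rw [abs_neg]; exact hb x
  have int : ∀ (m : Measure (Euc n)) (v f : Euc n → ℝ), Measurable v →
      ∫ x, f x ∂(m.withDensity fun x => ENNReal.ofReal (v x)) = ∫ x, max (v x) 0 * f x ∂m := by
    intro m v f hv
    rw [integral_withDensity_eq_integral_toReal_smul hv.ennreal_ofReal
      (Eventually.of_forall fun x => ENNReal.ofReal_lt_top)]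
    simp [ENNReal.toReal_ofReal']
  have hdiff : ∀ (m : Measure (Euc n)) [IsFiniteMeasure m] (f : Euc n → ℝ),
      (∀ᵐ x ∂m, x ∈ U) → BddContOn U f →
      ∫ x, max (w' x) 0 * f x ∂m - ∫ x, max (-w' x) 0 * f x ∂m = ∫ x, w x * f x ∂m := by
    intro m _ f hm' hf
    have hw'U : EqOn w' w U := fun x hx => indicator_of_mem hx _
    have hbw : BddContOn U w' := hw.congr hw'U
    rw [← integral_sub
      ((hbw.posPart.mul hf).integrable_of_ae_mem hU hm')
      ((hbw.neg.posPart.mul hf).integrable_of_ae_mem hU hm')]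
    refine integral_congr_ae (hm'.mono fun x hx => ?_)
    simp only [hw'U hx]
    rw [← sub_mul]
    congr 1
    rcases le_total 0 (w x) with h0 | h0
    · rw [max_eq_left h0, max_eq_right (by linarith)]; ring
    · rw [max_eq_right h0, max_eq_left (by linarith)]; ring
  have := fin p w' hb
  have := fin q w' hb
  have := fin p _ hb'
  have := fin q _ hb'
  have a₁ := ae_add_measure_iff.2 ⟨aem p w' hp, aem q (fun x => -w' x) hn⟩
  have a₂ := ae_add_measure_iff.2 ⟨aem p (fun x => -w' x) hp, aem q w' hn⟩
  have hs := suppOn_toSignedMeasure_sub a₁ a₂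
  refine ⟨_, hs, fun f hf => ?_⟩
  rw [sInt_toSignedMeasure_sub hs hU a₁ a₂ hf,
    integral_add_measure (hf.integrable_of_ae_mem hU (aem _ _ hp))
      (hf.integrable_of_ae_mem hU (aem _ _ hn)),
    integral_add_measure (hf.integrable_of_ae_mem hU (aem _ _ hp))
      (hf.integrable_of_ae_mem hU (aem _ _ hn)),
    int _ _ _ hm, int _ _ _ hm, int q (fun x => -w' x) f hm.neg,
    int p (fun x => -w' x) f hm.neg]
  have e₁ := hdiff p f hp hf
  have e₂ := hdiff q f hn hf
  unfold sInt
  linarith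

end SignedIntegral

section Approximation

variable {n : ℕ} {U : Set (Euc n)}

lemma abs_normed_convolution_le (ρ : ContDiffBump (0 : Euc n)) {g : Euc n → ℝ} {C : ℝ}
    (hg : Continuous g) (hC : ∀ x, |g x| ≤ C) (x : Euc n) :
    |convolution (ρ.normed volume) g (ContinuousLinearMap.lsmul ℝ ℝ) volume x| ≤ 3 * C := by
  have h := ρ.dist_normed_convolution_le (μ := volume) (x₀ := x) (ε := 2 * C)
    hg.aestronglyMeasurable fun y _ => by
      rw [Real.dist_eq]
      linarith [abs_sub (g y) (g x), hC x, hC y]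
  rw [Real.dist_eq] at h
  have := abs_sub_abs_le_abs_sub
    (convolution (ρ.normed volume) g (ContinuousLinearMap.lsmul ℝ ℝ) volume x) (g x)
  linarith [hC x]

lemma pd_normed_convolution (ρ : ContDiffBump (0 : Euc n)) {g : Euc n → ℝ} (hg : IsC1 g)
    (j : Fin n) (x : Euc n) :
    pd j (convolution (ρ.normed volume) g (ContinuousLinearMap.lsmul ℝ ℝ) volume) x =
      convolution (ρ.normed volume) (pd j g) (ContinuousLinearMap.lsmul ℝ ℝ) volume x := by
  have hl : LocallyIntegrable (ρ.normed volume) (volume : Measure (Euc n)) :=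
    ρ.continuous_normed.locallyIntegrable
  rw [pd, (hg.2.hasFDerivAt_convolution_right (ContinuousLinearMap.lsmul ℝ ℝ) hl hg.1 x).fderiv,
    convolution_precompR_apply _ hl (hg.2.fderiv ℝ) (hg.1.continuous_fderiv one_ne_zero)]
  rfl

lemma IsC1.continuous_pd {g : Euc n → ℝ} (hg : IsC1 g) (j : Fin n) : Continuous (pd j g) :=
  (hg.1.continuous_fderiv one_ne_zero).clm_apply continuous_const

lemma IsC1.hasCompactSupport_pd {g : Euc n → ℝ} (hg : IsC1 g) (j : Fin n) :
    HasCompactSupport (pd j g) :=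
  hg.2.fderiv_apply ℝ _

lemma IsC1.bddContOn {g : Euc n → ℝ} (hg : IsC1 g) (U : Set (Euc n)) : BddContOn U g :=
  BddContOn.of_hasCompactSupport hg.1.continuous hg.2

lemma IsC1.bddContOn_pd {g : Euc n → ℝ} (hg : IsC1 g) (U : Set (Euc n)) (j : Fin n) :
    BddContOn U (pd j g) :=
  BddContOn.of_hasCompactSupport (hg.continuous_pd j) (hg.hasCompactSupport_pd j)

lemma IsTestFun.isC1 {ψ : Euc n → ℝ} (h : IsTestFun U ψ) : IsC1 ψ :=
  ⟨h.1.of_le (mod_cast le_top), h.2.1⟩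

/-- Approximation of compactly supported `C¹` functions by test functions, in `C¹`, boundedly
and pointwise. -/
lemma IsC1.exists_isTestFun_tendsto (hU : IsOpen U) {g : Euc n → ℝ} (hg : IsC1 g)
    (hs : tsupport g ⊆ U) :
    ∃ ψ : ℕ → Euc n → ℝ, (∀ k, IsTestFun U (ψ k)) ∧
      (∃ C : ℝ, (∀ k x, |ψ k x| ≤ C) ∧ ∀ j k x, |pd j (ψ k) x| ≤ C) ∧
      (∀ x, Tendsto (fun k => ψ k x) atTop (𝓝 (g x))) ∧
      ∀ j x, Tendsto (fun k => pd j (ψ k) x) atTop (𝓝 (pd j g x)) := by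
  obtain ⟨δ, hδ, hδU⟩ := hg.2.isCompact.exists_cthickening_subset_open hU hs
  have hpos : ∀ k : ℕ, 0 < δ / (k + 1) := fun k => by positivity
  let ρ : ℕ → ContDiffBump (0 : Euc n) := fun k =>
    ⟨δ / (k + 1) / 2, δ / (k + 1), half_pos (hpos k), half_lt_self (hpos k)⟩
  have hρ : Tendsto (fun k => (ρ k).rOut) atTop (𝓝 0) := by
    have := (tendsto_one_div_add_atTop_nhds_zero_nat (𝕜 := ℝ)).const_mul δ
    simpa [ρ, div_eq_mul_inv] using this
  have hle : ∀ k, (ρ k).rOut ≤ δ := fun k =>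
    div_le_self hδ.le (by linarith [(Nat.cast_nonneg k : (0 : ℝ) ≤ k)])
  obtain ⟨C₀, hC₀⟩ := hg.2.exists_bound_of_continuous hg.1.continuous
  choose C₁ hC₁ using fun j =>
    (hg.hasCompactSupport_pd j).exists_bound_of_continuous (hg.continuous_pd j)
  simp only [Real.norm_eq_abs] at hC₀ hC₁
  refine ⟨fun k => convolution ((ρ k).normed volume) g (ContinuousLinearMap.lsmul ℝ ℝ) volume,
    fun k => ⟨?_, ?_, ?_⟩, ⟨3 * (|C₀| + ∑ j, |C₁ j|), fun k x => ?_, fun j k x => ?_⟩,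
    fun x => ?_, fun j x => ?_⟩
  · exact (ρ k).hasCompactSupport_normed.contDiff_convolution_left _ (ρ k).contDiff_normed
      hg.1.continuous.locallyIntegrable
  · exact HasCompactSupport.convolution _ (ρ k).hasCompactSupport_normed hg.2
  · refine (closure_minimal ?_ isClosed_cthickening).trans hδU
    refine (support_convolution_subset _).trans ?_
    rintro _ ⟨a, ha, b, hb, rfl⟩
    rw [ContDiffBump.support_normed_eq, mem_ball_zero_iff] at ha
    refine mem_cthickening_of_dist_le _ b _ _ (subset_tsupport _ hb) ?_
    simpa using (ha.le.trans (hle k))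
  · refine (abs_normed_convolution_le (ρ k) hg.1.continuous hC₀ x).trans ?_
    have : 0 ≤ ∑ j, |C₁ j| := Finset.sum_nonneg fun j _ => abs_nonneg _
    linarith [le_abs_self C₀]
  · rw [pd_normed_convolution _ hg]
    refine (abs_normed_convolution_le (ρ k) (hg.continuous_pd j) (hC₁ j) x).trans ?_
    have := Finset.single_le_sum (f := fun j => |C₁ j|) (fun j _ => abs_nonneg _)
      (Finset.mem_univ j)
    linarith [le_abs_self (C₁ j), abs_nonneg C₀]
  · exact ContDiffBump.convolution_tendsto_right_of_continuous hρ hg.1.continuous x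
  · simp only [pd_normed_convolution _ hg]
    exact ContDiffBump.convolution_tendsto_right_of_continuous hρ (hg.continuous_pd j) x

/-- Extension by zero of a `C¹` function on `U` vanishing outside a compact subset of `U`. -/
lemma isC1_indicator (hU : IsOpen U) {K : Set (Euc n)} (hK : IsCompact K) (hKU : K ⊆ U)
    {g : Euc n → ℝ} (hg : ContDiffOn ℝ 1 g U) (h0 : ∀ x ∈ U \ K, g x = 0) :
    IsC1 (U.indicator g) ∧ tsupport (U.indicator g) ⊆ U := by
  have hsupp : Function.support (U.indicator g) ⊆ K := by
    intro x hx
    by_contra hxK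
    refine hx ?_
    by_cases hxU : x ∈ U
    · rw [indicator_of_mem hxU, h0 x ⟨hxU, hxK⟩]
    · exact indicator_of_notMem hxU _
  have hts : tsupport (U.indicator g) ⊆ K := closure_minimal hsupp hK.isClosed
  refine ⟨⟨contDiff_iff_contDiffAt.2 fun x => ?_, hK.of_isClosed_subset (isClosed_tsupport _) hts⟩,
    hts.trans hKU⟩
  by_cases hxU : x ∈ U
  · refine (hg.contDiffAt (hU.mem_nhds hxU)).congr_of_eventuallyEq ?_
    filter_upwards [hU.mem_nhds hxU] with y hy using indicator_of_mem hy _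
  · refine (contDiffAt_const (c := (0 : ℝ))).congr_of_eventuallyEq ?_
    filter_upwards [hK.isClosed.isOpen_compl.mem_nhds fun h => hxU (hKU h)] with y hy
    by_contra h
    exact hy (hsupp h)

lemma eqOn_pd (hU : IsOpen U) {f g : Euc n → ℝ} (h : EqOn f g U) (j : Fin n) :
    EqOn (pd j f) (pd j g) U := by
  intro x hx
  have : f =ᶠ[𝓝 x] g := by filter_upwards [hU.mem_nhds hx] with y hy using h hy
  rw [pd, pd, this.fderiv_eq]

/-- The weak formulation of the divergence holds for `C¹` functions vanishing outside a compact
subset of `U`. -/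
lemma DivBV.weak_of_contDiffOn (hU : IsOpen U) (T : DivBV n U) {K : Set (Euc n)}
    (hK : IsCompact K) (hKU : K ⊆ U) {g : Euc n → ℝ} (hg : ContDiffOn ℝ 1 g U)
    (h0 : ∀ x ∈ U \ K, g x = 0) (i : Fin n) :
    ∑ j, sInt (T.A i j) (pd j g) = -sInt (T.divA i) g := by
  have hm := hU.measurableSet
  obtain ⟨hC1, hts⟩ := isC1_indicator hU hK hKU hg h0
  have e : EqOn g (U.indicator g) U := fun x hx => (indicator_of_mem hx _).symm
  rw [sInt_congr (T.suppDiv i) hm e, Finset.sum_congr rfl fun j _ =>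
    sInt_congr (T.suppA i j) hm (eqOn_pd hU e j)]
  obtain ⟨ψ, hψ, ⟨C, hC, hC'⟩, hl, hl'⟩ := hC1.exists_isTestFun_tendsto hU hts
  have t₁ : Tendsto (fun k => ∑ j, sInt (T.A i j) (pd j (ψ k))) atTop
      (𝓝 (∑ j, sInt (T.A i j) (pd j (U.indicator g)))) :=
    tendsto_finsetSum _ fun j _ => tendsto_sInt (T.suppA i j) hm
      (fun k => ((hψ k).isC1.continuous_pd j).continuousOn) (fun k x _ => hC' j k x)
      fun x _ => hl' j x
  have t₂ : Tendsto (fun k => -sInt (T.divA i) (ψ k)) atTop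
      (𝓝 (-sInt (T.divA i) (U.indicator g))) :=
    (tendsto_sInt (T.suppDiv i) hm (fun k => (hψ k).isC1.1.continuous.continuousOn)
      (fun k x _ => hC k x) fun x _ => hl x).neg
  exact tendsto_nhds_unique t₁ (t₂.congr fun k => (T.weak i _ (hψ k)).symm)

/-- Exhaustion of a bounded open set by cutoff functions. -/
lemma exists_cutoff (hU : IsOpen U) (hb : Bornology.IsBounded U) :
    ∃ χ : ℕ → Euc n → ℝ, (∀ k, IsC1 (χ k) ∧ tsupport (χ k) ⊆ U) ∧ (∀ k x, |χ k x| ≤ 1) ∧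
      ∀ x ∈ U, Tendsto (fun k => χ k x) atTop (𝓝 1) := by
  obtain ⟨F, hFc, hFU, hFun, hFm⟩ := hU.exists_iUnion_isClosed
  have hcomp : ∀ k, IsCompact (F k) := fun k =>
    Metric.isCompact_of_isClosed_isBounded (hFc k) (hb.subset (hFU k))
  choose L hL hFL hLU using fun k => exists_compact_between (hcomp k) hU (hFU k)
  choose χ h1 h0 hI using fun k => exists_contMDiffMap_one_nhds_of_subset_interior
    (n := 1) (modelWithCornersSelf ℝ (Euc n)) (hFc k) (hFL k)
  have hts : ∀ k, tsupport (χ k) ⊆ L k := fun k =>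
    closure_minimal (fun x hx => by_contra fun h => hx (h0 k x h)) (hL k).isClosed
  refine ⟨fun k => χ k, fun k => ⟨⟨(χ k).contMDiff.contDiff,
    (hL k).of_isClosed_subset (isClosed_tsupport _) (hts k)⟩, (hts k).trans (hLU k)⟩,
    fun k x => ?_, fun x hx => ?_⟩
  · rw [abs_of_nonneg (hI k x).1]
    exact (hI k x).2
  · rw [← hFun] at hx
    obtain ⟨m, hm⟩ := mem_iUnion.1 hx
    refine tendsto_const_nhds.congr' ?_
    filter_upwards [eventually_ge_atTop m] with k hk
    exact ((h1 k).self_of_nhdsSet x (hFm hk hm)).symm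

end Approximation

section PushForward

variable {n : ℕ} {U V : Set (Euc n)} {φ : Euc n → Euc n}

lemma contDiffOn_dcomp (hU : IsOpen U) (hφ : ContDiffOn ℝ 2 φ U) (i α : Fin n) :
    ContDiffOn ℝ 1 (dcomp φ i α) U := by
  have h : ContDiffOn ℝ 1 (fderiv ℝ φ) U := hφ.fderiv_of_isOpen hU (by norm_num)
  exact (EuclideanSpace.proj i : Euc n →L[ℝ] ℝ).contDiff.comp_contDiffOn
    (h.clm_apply contDiffOn_const)

lemma pd_dcomp (hU : IsOpen U) (hφ : ContDiffOn ℝ 2 φ U) (i α β : Fin n) {x : Euc n}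
    (hx : x ∈ U) : pd β (dcomp φ i α) x = d2comp φ i β α x := by
  have h : ContDiffOn ℝ 1 (fderiv ℝ φ) U := hφ.fderiv_of_isOpen hU (by norm_num)
  have hd := ((h.differentiableOn one_ne_zero).differentiableAt (hU.mem_nhds hx)).hasFDerivAt
  have h1 := hd.clm_apply (hasFDerivAt_const (EuclideanSpace.single α (1 : ℝ)) x)
  have h2 := (EuclideanSpace.proj i : Euc n →L[ℝ] ℝ).hasFDerivAt.comp x h1
  have e : fderiv ℝ (dcomp φ i α) x = _ := h2.fderiv
  rw [pd, e, d2comp]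
  simp

lemma abs_coord_le (v : Euc n) (i : Fin n) : |v i| ≤ ‖v‖ := by
  simpa using PiLp.norm_apply_le v i

lemma bddContOn_d2comp (hU : IsOpen U) (hφ : ContDiffOn ℝ 2 φ U) {C : ℝ≥0}
    (hlip : LipschitzOnWith C (fderiv ℝ φ) U) (i α β : Fin n) :
    BddContOn U (d2comp φ i α β) := by
  have h : ContDiffOn ℝ 1 (fderiv ℝ φ) U := hφ.fderiv_of_isOpen hU (by norm_num)
  have h2 : ContinuousOn (fderiv ℝ (fderiv ℝ φ)) U :=
    h.continuousOn_fderiv_of_isOpen hU le_rfl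
  refine ⟨(EuclideanSpace.proj i : Euc n →L[ℝ] ℝ).continuous.comp_continuousOn
    ((h2.clm_apply continuousOn_const).clm_apply continuousOn_const), C, fun x hx => ?_⟩
  refine (abs_coord_le _ i).trans ?_
  have := norm_fderiv_le_of_lipschitzOn ℝ (hU.mem_nhds hx) hlip
  refine (ContinuousLinearMap.le_opNorm _ _).trans ?_
  rw [PiLp.norm_single, norm_one, mul_one]
  refine (ContinuousLinearMap.le_opNorm _ _).trans ?_
  rwa [PiLp.norm_single, norm_one, mul_one]

lemma bddContOn_dcomp (hU : IsOpen U) (hb : Bornology.IsBounded U) (hφ : ContDiffOn ℝ 2 φ U)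
    {C : ℝ≥0} (hlip : LipschitzOnWith C (fderiv ℝ φ) U) (i α : Fin n) :
    BddContOn U (dcomp φ i α) := by
  rcases U.eq_empty_or_nonempty with rfl | ⟨x₀, hx₀⟩
  · exact ⟨continuousOn_empty _, 0, fun x hx => hx.elim⟩
  have hR : ∀ x ∈ U, ‖fderiv ℝ φ x‖ ≤ ‖fderiv ℝ φ x₀‖ + C * diam U := fun x hx =>
    calc ‖fderiv ℝ φ x‖ ≤ ‖fderiv ℝ φ x₀‖ + ‖fderiv ℝ φ x - fderiv ℝ φ x₀‖ := by
          linarith [norm_sub_norm_le (fderiv ℝ φ x) (fderiv ℝ φ x₀)]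
      _ ≤ ‖fderiv ℝ φ x₀‖ + C * diam U := by
          gcongr
          rw [← dist_eq_norm]
          refine (hlip.dist_le_mul x hx x₀ hx₀).trans ?_
          gcongr
          exact dist_le_diam_of_mem hb hx hx₀
  refine ⟨(contDiffOn_dcomp hU hφ i α).continuousOn, ‖fderiv ℝ φ x₀‖ + C * diam U, fun x hx => ?_⟩
  refine (abs_coord_le _ i).trans ((ContinuousLinearMap.le_opNorm _ _).trans ?_)
  rw [PiLp.norm_single, norm_one, mul_one]
  exact hR x hx

lemma pd_mul {f g : Euc n → ℝ} {x : Euc n} (hf : DifferentiableAt ℝ f x)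
    (hg : DifferentiableAt ℝ g x) (j : Fin n) :
    pd j (fun y => f y * g y) x = pd j f x * g x + f x * pd j g x := by
  have e : fderiv ℝ (fun y => f y * g y) x = _ := (hf.hasFDerivAt.mul hg.hasFDerivAt).fderiv
  rw [pd, e]
  simp [pd]
  ring

lemma pd_comp {f : Euc n → ℝ} {x : Euc n} (hf : DifferentiableAt ℝ f (φ x))
    (hφ : DifferentiableAt ℝ φ x) (α : Fin n) :
    pd α (fun y => f (φ y)) x = ∑ j, dcomp φ j α x * pd j f (φ x) := by
  have e : fderiv ℝ (fun y => f (φ y)) x = _ := (hf.hasFDerivAt.comp x hφ.hasFDerivAt).fderiv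
  rw [pd, e, ContinuousLinearMap.comp_apply]
  set v := fderiv ℝ φ x (EuclideanSpace.single α 1) with hv
  have hsum : v = ∑ j, v j • EuclideanSpace.single j (1 : ℝ) := by
    simpa using ((EuclideanSpace.basisFun (Fin n) ℝ).sum_repr v).symm
  conv_lhs => rw [hsum, map_sum]
  simp [dcomp, pd, hv]

lemma bddContOn_pd_of_compact (hU : IsOpen U) {K : Set (Euc n)} (hK : IsCompact K) (hKU : K ⊆ U)
    {g : Euc n → ℝ} (hg : ContDiffOn ℝ 1 g U) (h0 : ∀ x ∈ U \ K, g x = 0) (j : Fin n) :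
    BddContOn U (pd j g) := by
  have e : EqOn g (U.indicator g) U := fun x hx => (indicator_of_mem hx _).symm
  exact ((isC1_indicator hU hK hKU hg h0).1.bddContOn_pd U j).congr (eqOn_pd hU e j)

/-- The product rule for the pairing of `A` with the gradient of `f ∇φ_i`. -/
lemma DivBV.sum_sInt_pd_mul_dcomp (hU : IsOpen U) (hb : Bornology.IsBounded U)
    (hφ : ContDiffOn ℝ 2 φ U) {C : ℝ≥0} (hlip : LipschitzOnWith C (fderiv ℝ φ) U)
    (T : DivBV n U) {f : Euc n → ℝ} (hf : ContDiffOn ℝ 1 f U) (hfb : BddContOn U f)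
    (hfd : ∀ j, BddContOn U (pd j f)) (i : Fin n) :
    ∑ α, ∑ β, sInt (T.A α β) (pd β fun x => f x * dcomp φ i α x) =
      (∑ α, ∑ β, sInt (T.A α β) fun x => dcomp φ i β x * pd α f x) +
        ∑ α, ∑ β, sInt (T.A α β) fun x => d2comp φ i α β x * f x := by
  have hm := hU.measurableSet
  rw [← Finset.sum_add_distrib, Finset.sum_comm]
  refine Finset.sum_congr rfl fun β _ => ?_
  rw [← Finset.sum_add_distrib]
  refine Finset.sum_congr rfl fun α _ => ?_
  rw [T.symm α β, ← sInt_add (T.suppA β α) hm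
    ((bddContOn_dcomp hU hb hφ hlip i α).mul (hfd β))
    ((bddContOn_d2comp hU hφ hlip i β α).mul hfb)]
  refine sInt_congr (T.suppA β α) hm fun x hx => ?_
  rw [pd_mul ((hf.differentiableOn one_ne_zero).differentiableAt (hU.mem_nhds hx))
    (((contDiffOn_dcomp hU hφ i α).differentiableOn one_ne_zero).differentiableAt
      (hU.mem_nhds hx)), pd_dcomp hU hφ i α β hx]
  ring

/-- The distributional divergence of the vector field `A ∇φ_i`. -/
lemma DivBV.weak_mul_gradient (hU : IsOpen U) (hb : Bornology.IsBounded U)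
    (hφ : ContDiffOn ℝ 2 φ U) {C : ℝ≥0} (hlip : LipschitzOnWith C (fderiv ℝ φ) U)
    (T : DivBV n U) {K : Set (Euc n)} (hK : IsCompact K) (hKU : K ⊆ U)
    {g : Euc n → ℝ} (hg : ContDiffOn ℝ 1 g U) (h0 : ∀ x ∈ U \ K, g x = 0) (i : Fin n) :
    -(∑ α, ∑ β, sInt (T.A α β) fun x => dcomp φ i β x * pd α g x) =
      (∑ α, sInt (T.divA α) fun x => dcomp φ i α x * g x) +
        ∑ α, ∑ β, sInt (T.A α β) fun x => d2comp φ i α β x * g x := by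
  have key := T.sum_sInt_pd_mul_dcomp hU hb hφ hlip hg
    (BddContOn.of_compact hK hKU hg.continuousOn h0)
    (fun j => bddContOn_pd_of_compact hU hK hKU hg h0 j) i
  rw [Finset.sum_congr rfl fun α _ => T.weak_of_contDiffOn hU hK hKU
    (hg.mul (contDiffOn_dcomp hU hφ i α)) (fun x hx => by simp [h0 x hx]) α,
    Finset.sum_neg_distrib] at key
  have e : ∀ α, (fun x => dcomp φ i α x * g x) = fun x => g x * dcomp φ i α x :=
    fun α => funext fun x => mul_comm _ _
  simp only [e]
  linarith

/-- The measure representing the divergence of `A ∇φ_i`. -/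
lemma DivBV.exists_div_mul_gradient (hU : IsOpen U) (hb : Bornology.IsBounded U)
    (hφ : ContDiffOn ℝ 2 φ U) {C : ℝ≥0} (hlip : LipschitzOnWith C (fderiv ℝ φ) U)
    (T : DivBV n U) (i : Fin n) :
    ∃ μ : SignedMeasure (Euc n), SuppOn μ U ∧ ∀ f, BddContOn U f →
      sInt μ f = (∑ α, sInt (T.divA α) fun x => dcomp φ i α x * f x) +
        ∑ α, ∑ β, sInt (T.A α β) fun x => d2comp φ i α β x * f x := by
  have hm := hU.measurableSet
  choose m₁ hs₁ hm₁ using fun α =>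
    exists_sInt_eq_mul (T.suppDiv α) hm (bddContOn_dcomp hU hb hφ hlip i α)
  choose m₂ hs₂ hm₂ using fun p : Fin n × Fin n =>
    exists_sInt_eq_mul (T.suppA p.1 p.2) hm (bddContOn_d2comp hU hφ hlip i p.1 p.2)
  obtain ⟨μ₁, hμ₁, h₁⟩ := exists_sInt_eq_sum Finset.univ m₁ hm hs₁
  obtain ⟨μ₂, hμ₂, h₂⟩ := exists_sInt_eq_sum Finset.univ m₂ hm hs₂
  refine ⟨μ₁ + μ₂, hμ₁.add hμ₂, fun f hf => ?_⟩
  rw [sInt_add_measure hμ₁ hμ₂ hm hf, h₁ f hf, h₂ f hf, Fintype.sum_prod_type]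
  simp only [hm₁ _ f hf, hm₂ _ f hf]

/-- The first-order terms of the push-forward pairing, after the chain rule. -/
lemma DivBV.sum_sInt_pushforward (hU : IsOpen U) (hb : Bornology.IsBounded U)
    (hφ : ContDiffOn ℝ 2 φ U) {C : ℝ≥0} (hlip : LipschitzOnWith C (fderiv ℝ φ) U)
    (T : DivBV n U) {Z : Euc n → ℝ} (hZ : IsC1 Z) (i : Fin n) :
    (∑ j, ∑ α, ∑ β, sInt (T.A α β) fun x => dcomp φ i α x * dcomp φ j β x * pd j Z (φ x)) =
      ∑ α, ∑ β, sInt (T.A α β) fun x => dcomp φ i β x * pd α (fun y => Z (φ y)) x := by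
  have hm := hU.measurableSet
  rw [Finset.sum_comm, Finset.sum_congr rfl fun α _ => Finset.sum_comm, Finset.sum_comm]
  refine Finset.sum_congr rfl fun β _ => Finset.sum_congr rfl fun α _ => ?_
  rw [T.symm α β, ← sInt_sum _ (T.suppA β α) hm fun j =>
    ((bddContOn_dcomp hU hb hφ hlip i α).mul (bddContOn_dcomp hU hb hφ hlip j β)).mul
      ((hZ.bddContOn_pd univ j).comp hφ.continuousOn (mapsTo_univ _ _))]
  refine sInt_congr (T.suppA β α) hm fun x hx => ?_
  rw [pd_comp ((hZ.1.differentiable one_ne_zero) _)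
    ((hφ.differentiableOn two_ne_zero).differentiableAt (hU.mem_nhds hx)), Finset.mul_sum]
  exact Finset.sum_congr rfl fun j _ => by ring

/-- If a signed measure `ν` on `V` agrees with the image of `μ` on test functions, it agrees with
it on compactly supported `C¹` functions. -/
lemma sInt_eq_sInt_comp_of_isTestFun (hU : IsOpen U) (hV : IsOpen V)
    (hbV : Bornology.IsBounded V) (hφ : ContinuousOn φ U) (hmaps : MapsTo φ U V)
    {μ ν : SignedMeasure (Euc n)} (hμ : SuppOn μ U) (hν : SuppOn ν V)
    (h : ∀ ψ, IsTestFun V ψ → sInt ν ψ = sInt μ fun x => ψ (φ x)) {Z : Euc n → ℝ}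
    (hZ : IsC1 Z) : sInt ν Z = sInt μ fun x => Z (φ x) := by
  have limit : ∀ (F : ℕ → Euc n → ℝ) (f : Euc n → ℝ) (C : ℝ), (∀ k, Continuous (F k)) →
      (∀ k x, |F k x| ≤ C) → (∀ x ∈ V, Tendsto (fun k => F k x) atTop (𝓝 (f x))) →
      (∀ k, sInt ν (F k) = sInt μ fun x => F k (φ x)) → sInt ν f = sInt μ fun x => f (φ x) := by
    intro F f C hF hC hl he
    refine tendsto_nhds_unique (tendsto_sInt hν hV.measurableSet
      (fun k => (hF k).continuousOn) (fun k x _ => hC k x) hl) ?_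
    simp only [he]
    exact tendsto_sInt hμ hU.measurableSet (fun k => (hF k).comp_continuousOn hφ)
      (fun k x _ => hC k _) fun x hx => hl _ (hmaps hx)
  have hC1 : ∀ f, IsC1 f → tsupport f ⊆ V → sInt ν f = sInt μ fun x => f (φ x) := by
    intro f hf hs
    obtain ⟨ψ, hψ, ⟨C, hC, -⟩, hl, -⟩ := hf.exists_isTestFun_tendsto hV hs
    exact limit ψ f C (fun k => (hψ k).isC1.1.continuous) hC (fun x _ => hl x)
      fun k => h _ (hψ k)
  obtain ⟨χ, hχ, hχ1, hχl⟩ := exists_cutoff hV hbV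
  obtain ⟨-, C, hC⟩ := hZ.bddContOn univ
  refine limit (fun k x => χ k x * Z x) Z C
    (fun k => (hχ k).1.1.continuous.mul hZ.1.continuous) (fun k x => ?_) (fun x hx => ?_)
    fun k => hC1 _ ⟨(hχ k).1.1.mul hZ.1, hZ.2.mul_left⟩ ?_
  · rw [abs_mul]
    exact (mul_le_of_le_one_left (abs_nonneg _) (hχ1 k x)).trans (hC x (mem_univ x))
  · simpa using (hχl x hx).mul_const (Z x)
  · exact (tsupport_mul_subset_left).trans (hχ k).2

end PushForward

/-- Proposition 2.3 of the paper: the normal trace of the push-forward,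
`⟨γ_ν(φ_*A), Z⟩_{∂V} = ⟨γ_ν(A dφ), Z ∘ φ⟩_{∂ω} = Σ_i ⟨γ_ν(A ∇φ_i), Z_i ∘ φ⟩_{∂ω}`;
each vector field `A ∇φ_i` is div-BV, and `γ_ν(A ∇φ_i) = (γ_ν A) · ∇φ_i`. -/
theorem stmt8 (n : ℕ) (ω V : Set (Euc n)) (hω : IsOpen ω) (hV : IsOpen V)
    (hbω : Bornology.IsBounded ω) (hbV : Bornology.IsBounded V)
    (hneω : ω.Nonempty) (hneV : V.Nonempty)
    (Bω : CkDomain n 1 ω) (BV : CkDomain n 1 V)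
    (φ φinv : Euc n → Euc n)
    (hφ : ContDiffOn ℝ 2 φ (closure ω)) (hbij : Set.BijOn φ ω V)
    (hbijc : Set.BijOn φ (closure ω) (closure V))
    (hφinv : ContDiffOn ℝ 2 φinv (closure V)) (hleft : ∀ x ∈ closure ω, φinv (φ x) = x)
    (hlip : ∃ C : NNReal, LipschitzOnWith C (fderiv ℝ φ) ω)
    (T : DivBV n ω)
    -- `G` represents the divergence of the push-forward `φ_*A`
    (G : Fin n → MeasureTheory.SignedMeasure (Euc n))
    (hG : (∀ i, SuppOn (G i) V) ∧
      ∀ i, ∀ ψ : Euc n → ℝ, IsTestFun V ψ →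
        -(∑ j, ∑ α, ∑ β, sInt (T.A α β)
            (fun x => dcomp φ i α x * dcomp φ j β x * pd j ψ (φ x))) = sInt (G i) ψ) :
    -- the trace formula: `⟨γ_ν(φ_*A), Z⟩ = Σ_i ⟨γ_ν(A ∇φ_i), Z_i ∘ φ⟩`
    (∀ Z : Fin n → Euc n → ℝ, (∀ i, IsC1 (Z i)) →
      (∑ i, ∑ j, ∑ α, ∑ β, sInt (T.A α β)
          (fun x => dcomp φ i α x * dcomp φ j β x * pd j (Z i) (φ x))) +
        (∑ i, sInt (G i) (Z i)) =
      ∑ i, ((∑ α, ∑ β, sInt (T.A α β)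
          (fun x => dcomp φ i β x * pd α (fun y => Z i (φ y)) x)) +
        ((∑ α, sInt (T.divA α) (fun x => dcomp φ i α x * Z i (φ x))) +
          ∑ α, ∑ β, sInt (T.A α β) (fun x => d2comp φ i α β x * Z i (φ x))))) ∧
    -- each `A ∇φ_i` is a div-BV vector field
    (∀ i, ∃ μ : MeasureTheory.SignedMeasure (Euc n), SuppOn μ ω ∧
      ∀ ψ : Euc n → ℝ, IsTestFun ω ψ →
        -(∑ α, ∑ β, sInt (T.A α β) (fun x => dcomp φ i β x * pd α ψ x)) = sInt μ ψ) ∧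
    -- and `γ_ν(A ∇φ_i) = (γ_ν A) ⋅ ∇φ_i`
    (∀ i, ∀ f : Euc n → ℝ, IsC1 f →
      (∑ α, ∑ β, sInt (T.A α β) (fun x => dcomp φ i β x * pd α f x)) +
        ((∑ α, sInt (T.divA α) (fun x => dcomp φ i α x * f x)) +
          ∑ α, ∑ β, sInt (T.A α β) (fun x => d2comp φ i α β x * f x)) =
      T.tracePair (fun α x => f x * dcomp φ i α x)) := by
  obtain ⟨C, hlip⟩ := hlip
  have hφω : ContDiffOn ℝ 2 φ ω := hφ.mono subset_closure
  choose μ hμs hμ using fun i => T.exists_div_mul_gradient hω hbω hφω hlip i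
  have hGμ : ∀ i, ∀ ψ, IsTestFun V ψ → sInt (G i) ψ = sInt (μ i) fun x => ψ (φ x) := by
    intro i ψ hψ
    have hK : IsCompact (φinv '' tsupport ψ) :=
      hψ.2.1.isCompact.image_of_continuousOn
        (hφinv.continuousOn.mono (hψ.2.2.trans subset_closure))
    have hKω : φinv '' tsupport ψ ⊆ ω := by
      rintro _ ⟨y, hy, rfl⟩
      obtain ⟨x, hx, rfl⟩ := hbij.surjOn (hψ.2.2 hy)
      rwa [hleft x (subset_closure hx)]
    have h0 : ∀ x ∈ ω \ φinv '' tsupport ψ, ψ (φ x) = 0 := by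
      rintro x ⟨hx, hxK⟩
      by_contra hne
      exact hxK ⟨φ x, subset_tsupport _ hne, hleft x (subset_closure hx)⟩
    have hg : ContDiffOn ℝ 1 (fun x => ψ (φ x)) ω :=
      hψ.isC1.1.comp_contDiffOn (hφω.of_le one_le_two)
    rw [← hG.2 i ψ hψ, T.sum_sInt_pushforward hω hbω hφω hlip hψ.isC1 i,
      hμ i _ (BddContOn.of_compact hK hKω hg.continuousOn h0)]
    exact T.weak_mul_gradient hω hbω hφω hlip hK hKω hg h0 i
  refine ⟨fun Z hZ => ?_, fun i => ⟨μ i, hμs i, fun ψ hψ => ?_⟩, fun i f hf => ?_⟩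
  · rw [← Finset.sum_add_distrib]
    refine Finset.sum_congr rfl fun i _ => ?_
    rw [T.sum_sInt_pushforward hω hbω hφω hlip (hZ i) i,
      ← hμ i (fun x => Z i (φ x))
        (((hZ i).bddContOn V).comp hφω.continuousOn hbij.mapsTo),
      sInt_eq_sInt_comp_of_isTestFun hω hV hbV hφω.continuousOn hbij.mapsTo (hμs i) (hG.1 i)
        (hGμ i) (hZ i)]
  · rw [hμ i ψ (hψ.isC1.bddContOn ω)]
    exact T.weak_mul_gradient hω hbω hφω hlip hψ.2.1.isCompact hψ.2.2 hψ.isC1.1.contDiffOn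
      (fun x hx => image_eq_zero_of_notMem_tsupport hx.2) i
  · rw [DivBV.tracePair, T.sum_sInt_pd_mul_dcomp hω hbω hφω hlip hf.1.contDiffOn
      (hf.bddContOn ω) (hf.bddContOn_pd ω) i]
    simp only [mul_comm (f _)]
    ring

end
end
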